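/- arXiv:hep-th/0206233 — 3 statements merged into one kernel-verified Lean document; each statement's English description precedes it below -/
import Mathlib

section
/- Let n ≥ 3, s ≥ 1, and let V be a conformal Killing s-tensor on ℝⁿ. For a real parameter w define the s-th order operator D_V^{(w)} f = Σ_{k=0}^{s} c_k(w) · Σ_{a₁,…,a_{s−k}, b₁,…,b_k} (∂_{a₁} ⋯ ∂_{a_{s−k}} V^{a₁⋯a_{s−k} b₁⋯b_k}) (∂_{b₁} ⋯ ∂_{b_k} f), where c_k(w) = (−1)^{s−k} · binom(s,k) · Π_{i=0}^{s−k−1} (w − s + 1 + i)/(n + 2s − 2 − i). Then with w₁ = 1 − n/2 and w₂ = −1 − n/2, for every smooth f : ℝⁿ → ℝ one has Δ(D_V^{(w₁)} f) = D_V^{(w₂)}(Δ f). In particular D_V^{(1−n/2)} maps harmonic functions to harmonic functions and has symbol V. -/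
/-- Partial derivative in the `a`-th coordinate direction. -/
noncomputable def pd {n : ℕ} (a : Fin n) (f : (Fin n → ℝ) → ℝ) : (Fin n → ℝ) → ℝ :=
  fun x => fderiv ℝ f x (Pi.single a (1 : ℝ))

/-- Iterated partial derivatives `∂_{a₁} ⋯ ∂_{a_m} f`. -/
noncomputable def pds {n : ℕ} : {m : ℕ} → (Fin m → Fin n) → ((Fin n → ℝ) → ℝ) →
    ((Fin n → ℝ) → ℝ)
  | 0, _, f => f
  | _ + 1, a, f => pd (a 0) (pds (fun i => a i.succ) f)

/-- The Laplacian `Δf = Σ_a ∂_a ∂_a f`. -/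
noncomputable def lap {n : ℕ} (f : (Fin n → ℝ) → ℝ) : (Fin n → ℝ) → ℝ :=
  fun x => ∑ a, pd a (pd a f) x

/-- A smooth field of symmetric trace-free `s`-tensors on ℝⁿ. -/
def IsSTF (n s : ℕ) (V : (Fin n → ℝ) → (Fin s → Fin n) → ℝ) : Prop :=
  (∀ b, ContDiff ℝ (⊤ : ℕ∞) fun x => V x b) ∧
  (∀ (x : Fin n → ℝ) (σ : Equiv.Perm (Fin s)) (b : Fin s → Fin n), V x (b ∘ σ) = V x b) ∧
  (∀ (x : Fin n → ℝ) (i j : Fin s), i ≠ j → ∀ b : Fin s → Fin n,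
    ∑ e : Fin n, V x (Function.update (Function.update b i e) j e) = 0)

/-- The divergence `w^{b₂⋯b_s} = Σ_e ∂_e V^{e b₂⋯b_s}` of an `s`-tensor field. -/
noncomputable def divT (n s : ℕ) (V : (Fin n → ℝ) → (Fin s → Fin n) → ℝ)
    (x : Fin n → ℝ) (b : Fin (s - 1) → Fin n) : ℝ :=
  ∑ e : Fin n, pd e (fun y => V y fun j =>
    if h : (j : ℕ) = 0 then e else b ⟨(j : ℕ) - 1, by have := j.isLt; omega⟩) x

/-- A conformal Killing `s`-tensor on ℝⁿ: a smooth symmetric trace-free `s`-tensor field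
such that the full symmetrization over the `s+1` indices of `∂_a V^{b₁⋯b_s}` equals
`(s/(n+2s−2))` times the full symmetrization of `δ_{a b₁} w^{b₂⋯b_s}`. -/
def IsCKT (n s : ℕ) (V : (Fin n → ℝ) → (Fin s → Fin n) → ℝ) : Prop :=
  IsSTF n s V ∧
  ∀ (x : Fin n → ℝ) (c : Fin (s + 1) → Fin n),
    ∑ σ : Equiv.Perm (Fin (s + 1)),
        pd (c (σ 0)) (fun y => V y fun i => c (σ i.succ)) x
      = (s : ℝ) / ((n : ℝ) + 2 * s - 2) *
        ∑ σ : Equiv.Perm (Fin (s + 1)),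
          (if c (σ 0) = c (σ 1) then (1 : ℝ) else 0) *
            divT n s V x fun i => c (σ ⟨(i : ℕ) + 2, by have := i.isLt; omega⟩)

/-- The coefficient `c_k(w) = (−1)^{s−k} binom(s,k) Π_{i=0}^{s−k−1} (w−s+1+i)/(n+2s−2−i)`. -/
noncomputable def coeffC (n s : ℕ) (w : ℝ) (k : ℕ) : ℝ :=
  (-1) ^ (s - k) * (s.choose k : ℝ) *
    ∏ i ∈ Finset.range (s - k), (w - s + 1 + i) / ((n : ℝ) + 2 * s - 2 - i)

/-- The operator `D_V^{(w)} f = Σ_{k=0}^s c_k(w) Σ_{a,b} (∂_{a₁}⋯∂_{a_{s−k}} V^{a b})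
(∂_{b₁}⋯∂_{b_k} f)`. -/
noncomputable def opDw (n s : ℕ) (w : ℝ) (V : (Fin n → ℝ) → (Fin s → Fin n) → ℝ)
    (f : (Fin n → ℝ) → ℝ) : (Fin n → ℝ) → ℝ :=
  fun x => ∑ k ∈ Finset.range (s + 1), coeffC n s w k *
    ∑ a : Fin (s - k) → Fin n, ∑ b : Fin k → Fin n,
      pds a (fun y => V y fun j =>
          if h : (j : ℕ) < s - k then a ⟨(j : ℕ), h⟩
          else b ⟨(j : ℕ) - (s - k), by have := j.isLt; omega⟩) x
        * pds b f x

namespace ConformalSymbol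

open scoped TensorProduct ContDiff
open MvPolynomial (X pderiv)

/-- The Leibniz rule for a product indexed by `Fin (k + 1)`. -/
theorem derivation_fin_prod {P : Type*} [CommRing P] [Algebra ℝ P] (D : Derivation ℝ P P) {k : ℕ}
    (g : Fin (k + 1) → P) :
    D (∏ i, g i) = ∑ i, D (g i) * ∏ j, g (i.succAbove j) := by
  induction k with
  | zero => simp
  | succ k ih =>
    rw [Fin.prod_univ_succ, D.leibniz, ih, Fin.sum_univ_succ (n := k + 1)]
    have h : ∀ i : Fin (k + 1),
        ∏ j, g (i.succ.succAbove j) = g 0 * ∏ j, g (i.succAbove j).succ := fun i => by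
      simp [Fin.prod_univ_succ fun j => g (i.succ.succAbove j)]
    simp only [h, Fin.zero_succAbove, smul_eq_mul, Finset.mul_sum]
    rw [add_comm, mul_comm]
    congr 1
    exact Finset.sum_congr rfl fun i _ => by ring

section Operators

variable {n : ℕ} {A : Type*} [CommRing A] [Algebra ℝ A]
  (φ : MvPolynomial (Fin n) ℝ →ₐ[ℝ] Module.End ℝ A)

/-- The operator `ξ · ∂_x` on symbols, where `∂_a` acts on the coefficients as `φ (X a)`. -/
noncomputable def symGrad : Module.End ℝ (A ⊗[ℝ] MvPolynomial (Fin n) ℝ) :=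
  ∑ a, TensorProduct.map (φ (X a)) (LinearMap.mulLeft ℝ (X a))

/-- The operator `∂_ξ · ∂_x` on symbols. -/
noncomputable def symDiv : Module.End ℝ (A ⊗[ℝ] MvPolynomial (Fin n) ℝ) :=
  ∑ a, TensorProduct.map (φ (X a)) (pderiv a).toLinearMap

/-- The Laplacian in `x` on symbols. -/
noncomputable def symLap : Module.End ℝ (A ⊗[ℝ] MvPolynomial (Fin n) ℝ) :=
  TensorProduct.map (φ (∑ a, X a ^ 2)) LinearMap.id

variable (A n) in
/-- Multiplication of symbols by `|ξ|²`. -/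
noncomputable def symSq : Module.End ℝ (A ⊗[ℝ] MvPolynomial (Fin n) ℝ) :=
  TensorProduct.map LinearMap.id (LinearMap.mulLeft ℝ (∑ a, X a ^ 2))

@[simp] theorem symGrad_tmul (u : A) (p : MvPolynomial (Fin n) ℝ) :
    symGrad φ (u ⊗ₜ p) = ∑ a, φ (X a) u ⊗ₜ (X a * p) := by
  simp [symGrad]

@[simp] theorem symDiv_tmul (u : A) (p : MvPolynomial (Fin n) ℝ) :
    symDiv φ (u ⊗ₜ p) = ∑ a, φ (X a) u ⊗ₜ pderiv a p := by
  simp [symDiv]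

@[simp] theorem symLap_tmul (u : A) (p : MvPolynomial (Fin n) ℝ) :
    symLap φ (u ⊗ₜ p) = φ (∑ a, X a ^ 2) u ⊗ₜ p := by
  simp [symLap]

@[simp] theorem symSq_tmul (u : A) (p : MvPolynomial (Fin n) ℝ) :
    symSq n A (u ⊗ₜ p) = u ⊗ₜ ((∑ a, X a ^ 2) * p) := by
  simp [symSq]

theorem symDiv_symGrad (z : A ⊗[ℝ] MvPolynomial (Fin n) ℝ) :
    symDiv φ (symGrad φ z) = symGrad φ (symDiv φ z) + symLap φ z := by
  induction z with
  | zero => simp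
  | add y z hy hz => simp only [map_add, hy, hz]; abel
  | tmul u p =>
    have key : ∀ a b : Fin n, φ (X b) (φ (X a) u) = φ (X a) (φ (X b) u) := fun a b => by
      rw [← Module.End.mul_apply, ← Module.End.mul_apply, ← map_mul, ← map_mul, mul_comm]
    simp only [symGrad_tmul, symDiv_tmul, symLap_tmul, map_sum, Derivation.leibniz, smul_eq_mul,
      MvPolynomial.pderiv_X, TensorProduct.tmul_add, Finset.sum_add_distrib]
    congr 1
    · rw [Finset.sum_comm]
      simp only [key]
    · simp only [Pi.single_apply, mul_ite, mul_one, mul_zero, pow_two,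
        LinearMap.sum_apply, TensorProduct.sum_tmul]
      refine Finset.sum_congr rfl fun a _ => ?_
      rw [Finset.sum_eq_single a (fun b _ hb => by simp [hb.symm]) (by simp)]
      simp

theorem symDiv_symSq (z : A ⊗[ℝ] MvPolynomial (Fin n) ℝ) :
    symDiv φ (symSq n A z) = symSq n A (symDiv φ z) + (2 : ℝ) • symGrad φ z := by
  induction z with
  | zero => simp
  | add y z hy hz => simp only [map_add, hy, hz, smul_add]; abel
  | tmul u p =>
    simp only [symGrad_tmul, symDiv_tmul, symSq_tmul, map_sum, Derivation.leibniz, smul_eq_mul,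
      TensorProduct.tmul_add, Finset.sum_add_distrib, Finset.smul_sum]
    congr 1
    refine Finset.sum_congr rfl fun a _ => ?_
    rw [← TensorProduct.tmul_smul]
    congr 1
    simp [Derivation.leibniz_pow, MvPolynomial.pderiv_X, Pi.single_apply, two_smul]
    ring

theorem symDiv_symLap (z : A ⊗[ℝ] MvPolynomial (Fin n) ℝ) :
    symDiv φ (symLap φ z) = symLap φ (symDiv φ z) := by
  induction z with
  | zero => simp
  | add y z hy hz => simp only [map_add, hy, hz]
  | tmul u p =>
    rw [symDiv_tmul, symLap_tmul, symDiv_tmul, map_sum (symLap φ)]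
    refine Finset.sum_congr rfl fun a _ => ?_
    rw [symLap_tmul, ← Module.End.mul_apply, ← Module.End.mul_apply, ← map_mul,
      ← map_mul, mul_comm]

/-- The differential operator with a given symbol, applied to `f`. -/
noncomputable def quantize (f : A) : A ⊗[ℝ] MvPolynomial (Fin n) ℝ →ₗ[ℝ] A :=
  TensorProduct.lift ((LinearMap.mul ℝ A).compl₂ (φ.toLinearMap.flip f))

@[simp] theorem quantize_tmul (f u : A) (p : MvPolynomial (Fin n) ℝ) :
    quantize φ f (u ⊗ₜ p) = u * φ p f := by
  simp [quantize]

theorem quantize_symSq (f : A) (z : A ⊗[ℝ] MvPolynomial (Fin n) ℝ) :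
    quantize φ f (symSq n A z) = quantize φ (φ (∑ a, X a ^ 2) f) z := by
  induction z with
  | zero => simp
  | add y z hy hz => simp only [map_add, hy, hz]
  | tmul u p =>
    rw [symSq_tmul, quantize_tmul, quantize_tmul, mul_comm (∑ a, _), map_mul φ, Module.End.mul_apply]

theorem quantize_comp_lap
    (hφ : ∀ a (u v : A), φ (X a) (u * v) = φ (X a) u * v + u * φ (X a) v)
    (f : A) (z : A ⊗[ℝ] MvPolynomial (Fin n) ℝ) :
    φ (∑ a, X a ^ 2) (quantize φ f z) =
      quantize φ f (symLap φ z + (2 : ℝ) • symGrad φ z + symSq n A z) := by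
  induction z with
  | zero => simp
  | add y z hy hz => simp only [map_add, hy, hz, smul_add]; abel
  | tmul u p =>
    simp only [symGrad_tmul, symLap_tmul, symSq_tmul, map_add, map_sum, quantize_tmul,
      LinearMap.sum_apply, pow_two, Module.End.mul_apply, hφ, map_smul, Finset.smul_sum,
      Finset.sum_mul, map_mul, ← Finset.sum_add_distrib, TensorProduct.sum_tmul,
      TensorProduct.tmul_sum]
    refine Finset.sum_congr rfl fun a _ => ?_
    rw [two_smul]
    ring

/-- The polynomial symbol attached to a tensor. -/
noncomputable def symbol {k : ℕ} (T : (Fin k → Fin n) → A) : A ⊗[ℝ] MvPolynomial (Fin n) ℝ :=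
  ∑ b, T b ⊗ₜ ∏ i, X (b i)

theorem symDiv_symbol {k : ℕ} (T : (Fin (k + 1) → Fin n) → A)
    (hT : ∀ (i : Fin (k + 1)) (e : Fin n) (b : Fin k → Fin n),
      T (i.insertNth e b) = T (Fin.cons e b)) :
    symDiv φ (symbol T) =
      ((k : ℝ) + 1) • symbol fun b => ∑ e, φ (X e) (T (Fin.cons e b)) := by
  have h : ∀ b : Fin (k + 1) → Fin n, symDiv φ (T b ⊗ₜ ∏ i, X (b i)) =
      ∑ i, φ (X (b i)) (T b) ⊗ₜ ∏ j, X (b (i.succAbove j)) := fun b => by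
    simp only [symDiv_tmul, derivation_fin_prod, TensorProduct.tmul_sum]
    rw [Finset.sum_comm]
    refine Finset.sum_congr rfl fun i _ => ?_
    rw [Finset.sum_eq_single (b i)]
    · simp
    · intro a _ ha
      simp [MvPolynomial.pderiv_X, ha.symm]
    · simp
  have h' : ∀ i : Fin (k + 1),
      ∑ b : Fin (k + 1) → Fin n, φ (X (b i)) (T b) ⊗ₜ[ℝ] ∏ j, X (R := ℝ) (b (i.succAbove j)) =
        symbol fun b => ∑ e, φ (X e) (T (Fin.cons e b)) := fun i => by
    rw [← (Fin.insertNthEquiv (fun _ => Fin n) i).sum_comp, Fintype.sum_prod_type_right]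
    simp [Fin.insertNthEquiv, symbol, hT, TensorProduct.sum_tmul]
  rw [symbol, map_sum]
  simp only [h]
  rw [Finset.sum_comm]
  simp only [h', Finset.sum_const, Finset.card_univ, Fintype.card_fin]
  rw [← Nat.cast_smul_eq_nsmul ℝ]
  push_cast
  rfl

end Operators

theorem exists_perm_comp_eq {α β : Type*} [Fintype α] [DecidableEq β] {c c' : α → β}
    (h : ∀ e, (∑ i, if c i = e then 1 else 0) = ∑ i, if c' i = e then 1 else 0) :
    ∃ σ : Equiv.Perm α, c' ∘ σ = c := by
  have hcard : ∀ e, Fintype.card {i // c i = e} = Fintype.card {i // c' i = e} := fun e => by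
    simpa [Fintype.card_subtype] using h e
  exact ⟨Equiv.ofFiberEquiv fun e => Fintype.equivOfCardEq (hcard e),
    funext fun i => Equiv.ofFiberEquiv_map _ i⟩

/-- Concatenation of index tuples, with total length `s = j + k`. -/
def glue {n s j k : ℕ} (h : s ≤ j + k) (a : Fin j → Fin n) (b : Fin k → Fin n) : Fin s → Fin n :=
  fun i => if hi : (i : ℕ) < j then a ⟨i, hi⟩ else b ⟨(i : ℕ) - j, by have := i.isLt; omega⟩

theorem sum_glue {n s j k : ℕ} (h : s = j + k) (a : Fin j → Fin n) (b : Fin k → Fin n)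
    (F : Fin n → ℕ) : ∑ i, F (glue h.le a b i) = ∑ i, F (a i) + ∑ i, F (b i) := by
  subst h
  simp [Fin.sum_univ_add, glue]

theorem eq_of_count_eq {n s : ℕ} {A : Type*} {V : (Fin s → Fin n) → A}
    (hV : ∀ (σ : Equiv.Perm (Fin s)) b, V (b ∘ σ) = V b) {c c' : Fin s → Fin n}
    (h : ∀ e, (∑ i, if c i = e then 1 else 0) = ∑ i, if c' i = e then 1 else 0) : V c = V c' := by
  obtain ⟨σ, rfl⟩ := exists_perm_comp_eq h
  exact hV σ c'

section Symmetric

variable {n : ℕ} {A : Type*} [CommRing A] [Algebra ℝ A]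
  (φ : MvPolynomial (Fin n) ℝ →ₐ[ℝ] Module.End ℝ A)

/-- Iterated divergences of the symbol of a symmetric tensor. -/
theorem symDiv_pow_symbol {s : ℕ} (V : (Fin s → Fin n) → A)
    (hV : ∀ (σ : Equiv.Perm (Fin s)) b, V (b ∘ σ) = V b) {j k : ℕ} (h : s = j + k) :
    (k.factorial : ℝ) • (symDiv φ ^ j) (symbol V) =
      (s.factorial : ℝ) • symbol fun b : Fin k → Fin n =>
        ∑ a : Fin j → Fin n, φ (∏ i, X (a i)) (V (glue h.le a b)) := by
  induction j generalizing k with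
  | zero =>
    obtain rfl : s = k := by omega
    have hg : ∀ b : Fin s → Fin n, glue h.le default b = b := fun b => by
      funext i
      simp [glue]
    simp [hg]
  | succ j ih =>
    have hk : s = j + (k + 1) := by omega
    have ih := congrArg (symDiv φ) (ih hk)
    rw [map_smul, map_smul, symDiv_symbol, ← Module.End.mul_apply, ← pow_succ',
      Nat.factorial_succ, smul_comm] at ih
    · push_cast at ih
      rw [mul_smul] at ih
      have ih := smul_right_injective _ (Nat.cast_add_one_ne_zero k : (k : ℝ) + 1 ≠ 0) ih
      rw [ih]
      congr 2
      funext b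
      rw [← (Fin.consEquiv fun _ => Fin n).sum_comp, Fintype.sum_prod_type]
      refine Finset.sum_congr rfl fun e _ => ?_
      rw [map_sum]
      refine Finset.sum_congr rfl fun a _ => ?_
      rw [← Module.End.mul_apply, ← map_mul]
      simp only [Fin.consEquiv, Equiv.coe_fn_mk, Fin.prod_univ_succ, Fin.cons_zero, Fin.cons_succ]
      congr 1
      refine eq_of_count_eq hV fun x => ?_
      rw [sum_glue hk a _ fun y => if y = x then 1 else 0,
        sum_glue h _ b fun y => if y = x then 1 else 0, Fin.sum_univ_succ, Fin.sum_univ_succ]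
      simp only [Fin.cons_zero, Fin.cons_succ]
      ring
    · intro i e b
      refine Finset.sum_congr rfl fun a _ => ?_
      congr 1
      refine eq_of_count_eq hV fun x => ?_
      rw [sum_glue hk a _ fun y => if y = x then 1 else 0,
        sum_glue hk a _ fun y => if y = x then 1 else 0, Fin.sum_univ_succAbove _ i,
        Fin.sum_univ_succ]
      simp

theorem symbol_sum_perm {k : ℕ} (F : (Fin k → Fin n) → A) :
    symbol (fun c => ∑ σ : Equiv.Perm (Fin k), F (c ∘ σ)) = (k.factorial : ℝ) • symbol F := by
  have h : ∀ σ : Equiv.Perm (Fin k),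
      ∑ c : Fin k → Fin n, F (c ∘ σ) ⊗ₜ[ℝ] ∏ i, X (R := ℝ) (c i) = symbol F := fun σ => by
    rw [symbol, ← (Equiv.arrowCongr σ (Equiv.refl (Fin n))).sum_comp]
    refine Finset.sum_congr rfl fun c _ => ?_
    congr 1
    · congr 1
      ext i
      simp [Equiv.arrowCongr]
    · exact σ.symm.prod_comp fun i => X (R := ℝ) (c i)
  simp only [symbol, TensorProduct.sum_tmul] at h ⊢
  rw [Finset.sum_comm]
  simp only [h, Finset.sum_const, Finset.card_univ, Fintype.card_perm, Fintype.card_fin]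
  rw [Nat.cast_smul_eq_nsmul]

theorem symbol_grad {k : ℕ} (V : (Fin k → Fin n) → A) :
    symbol (fun c : Fin (k + 1) → Fin n => φ (X (c 0)) (V fun i => c i.succ)) =
      symGrad φ (symbol V) := by
  rw [symbol, ← (Fin.consEquiv fun _ => Fin n).sum_comp, Fintype.sum_prod_type_right, symbol,
    map_sum]
  simp [Fin.consEquiv, Fin.prod_univ_succ]

theorem symbol_delta {k : ℕ} (W : (Fin k → Fin n) → A) :
    symbol (fun c : Fin (k + 2) → Fin n =>
      (if c 0 = c 1 then (1 : ℝ) else 0) • W fun i => c i.succ.succ) = symSq n A (symbol W) := by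
  rw [symbol, ← (Fin.consEquiv fun _ => Fin n).sum_comp, Fintype.sum_prod_type_right,
    ← (Fin.consEquiv fun _ => Fin n).sum_comp, Fintype.sum_prod_type_right, symbol, map_sum]
  refine Finset.sum_congr rfl fun b _ => ?_
  rw [symSq_tmul, Finset.sum_mul, TensorProduct.tmul_sum]
  refine Finset.sum_congr rfl fun e _ => ?_
  rw [Finset.sum_eq_single e]
  · simp [Fin.consEquiv, Fin.prod_univ_succ, pow_two, mul_assoc]
  · intro e' _ he
    simp [Fin.consEquiv, he]
  · simp

/-- The conformal Killing equation in terms of symbols. -/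
theorem symGrad_symbol_of_ckt {m : ℕ} (V : (Fin (m + 1) → Fin n) → A)
    (hV : ∀ (σ : Equiv.Perm (Fin (m + 1))) b, V (b ∘ σ) = V b) (N : ℝ) (hN : N ≠ 0)
    (h : ∀ c : Fin (m + 2) → Fin n,
      ∑ σ : Equiv.Perm (Fin (m + 2)), φ (X (c (σ 0))) (V fun i => c (σ i.succ)) =
        (((m : ℝ) + 1) / N) • ∑ σ : Equiv.Perm (Fin (m + 2)),
          (if c (σ 0) = c (σ 1) then (1 : ℝ) else 0) •
            ∑ e, φ (X e) (V (Fin.cons e fun i => c (σ i.succ.succ)))) :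
    N • symGrad φ (symbol V) = symSq n A (symDiv φ (symbol V)) := by
  have h1 := symbol_sum_perm fun c : Fin (m + 2) → Fin n => φ (X (c 0)) (V fun i => c i.succ)
  have h2 := symbol_sum_perm fun c : Fin (m + 2) → Fin n =>
    (if c 0 = c 1 then (1 : ℝ) else 0) • ∑ e, φ (X e) (V (Fin.cons e fun i => c i.succ.succ))
  have h3 : ∀ (r : ℝ) (F : (Fin (m + 2) → Fin n) → A),
      symbol (fun c => r • F c) = r • symbol F := fun r F => by
    simp [symbol, Finset.smul_sum, TensorProduct.smul_tmul']
  simp only [Function.comp_apply] at h1 h2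
  rw [funext h, h3, h2, symbol_grad, smul_comm,
    symbol_delta fun b => ∑ e, φ (X e) (V (Fin.cons e b))] at h1
  have h4 := smul_right_injective _
    (Nat.cast_ne_zero.2 (Nat.factorial_ne_zero _) : ((m + 2).factorial : ℝ) ≠ 0) h1
  rw [← h4, symDiv_symbol, map_smul, smul_smul, mul_div_cancel₀ _ hN]
  intro i e b
  refine eq_of_count_eq hV fun x => ?_
  rw [Fin.sum_univ_succAbove _ i, Fin.sum_univ_succ]
  simp

end Symmetric

section Coefficients

/-- The coefficient of the `j`-fold divergence in the symbol, with `u = w - s + 1`. -/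
noncomputable def divCoeff (N u : ℝ) (j : ℕ) : ℝ :=
  (-1) ^ j / j.factorial * ∏ i ∈ Finset.range j, (u + i) / (N - i)

theorem divCoeff_succ (N u : ℝ) (j : ℕ) :
    divCoeff N u (j + 1) = -((u + j) / ((j + 1) * (N - j))) * divCoeff N u j := by
  rw [divCoeff, divCoeff, Finset.prod_range_succ, Nat.factorial_succ, pow_succ]
  push_cast
  have := j.factorial_ne_zero
  have : (j : ℝ) + 1 ≠ 0 := Nat.cast_add_one_ne_zero j
  rw [← div_mul_div_comm]
  field_simp

/-- Lowering the weight `u` by `2`. -/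
theorem divCoeff_sub_two (N u : ℝ) (j : ℕ) (h : (j : ℝ) + 1 < N) :
    divCoeff N (u - 2) (j + 2) =
      (u - 2) * (u - 1) / ((j + 1) * (j + 2) * (N - j) * (N - j - 1)) * divCoeff N u j := by
  induction j with
  | zero =>
    push_cast at h
    have h0 : N ≠ 0 := by linarith
    have h1 : N - 1 ≠ 0 := by linarith
    simp [divCoeff, Finset.prod_range_succ]
    field_simp
    ring
  | succ j ih =>
    push_cast at h
    rw [divCoeff_succ, ih (by linarith), divCoeff_succ]
    have h0 : N - j ≠ 0 := by linarith
    have h1 : N - j - 1 ≠ 0 := by linarith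
    have h2 : N - (j + 1) ≠ 0 := by linarith
    have h3 : N - (j + 2) ≠ 0 := by linarith
    have h4 : N - (j + 1) - 1 ≠ 0 := by linarith
    push_cast
    field_simp
    ring

theorem two_mul_divCoeff_succ (N : ℝ) (j : ℕ) (h : (j : ℝ) < N) :
    2 * ((j + 1) * (N - j) * divCoeff N (1 - N / 2) (j + 1)) =
      (N - 2 * j - 2) * divCoeff N (1 - N / 2) j := by
  have h0 : N - j ≠ 0 := by linarith
  rw [divCoeff_succ]
  field_simp
  ring

theorem divCoeff_sub_divCoeff (N : ℝ) (j : ℕ) (h : (j : ℝ) + 1 < N) :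
    (j + 1) * (N - j) * (divCoeff N (1 - N / 2) (j + 2) - divCoeff N (1 - N / 2 - 2) (j + 2)) =
      -divCoeff N (1 - N / 2) j := by
  have h0 : N - j ≠ 0 := by linarith
  have h1 : N - j - 1 ≠ 0 := by linarith
  have h2 : N - (j + 1) ≠ 0 := by linarith
  rw [divCoeff_sub_two _ _ _ h, divCoeff_succ, divCoeff_succ]
  push_cast
  field_simp
  ring

end Coefficients

/-- The summation identity behind the intertwining property: if `x`, `y`, `z` are the images of
the iterated divergences under the Laplacian, the gradient and multiplication by `|ξ|²`. -/
theorem sum_divCoeff {M : Type*} [AddCommGroup M] [Module ℝ M] (N : ℝ) (s : ℕ)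
    (hN : (s : ℝ) + 1 < N) (x y z : ℕ → M) (h0 : N • y 0 = z 1)
    (h : ∀ j : ℕ, (N - 2 * j - 2) • y (j + 1) + ((j + 1) * (N - j)) • x j = z (j + 2))
    (hx : ∀ j, s < j → x j = 0) (hy : ∀ j, s < j → y j = 0) (hz : ∀ j, s < j → z j = 0) :
    ∑ j ∈ Finset.range (s + 1), divCoeff N (1 - N / 2) j • (x j + (2 : ℝ) • y j + z j) =
      ∑ j ∈ Finset.range (s + 1), divCoeff N (1 - N / 2 - 2) j • z j := by
  set α := divCoeff N (1 - N / 2) with hα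
  set β := divCoeff N (1 - N / 2 - 2) with hβ
  have key : ∀ m ≤ s + 1,
      ∑ j ∈ Finset.range (m + 2), (α j • (x j + (2 : ℝ) • y j + z j) - β j • z j) =
        α m • x m + α (m + 1) • x (m + 1) + (2 * α (m + 1)) • y (m + 1) := by
    intro m
    induction m with
    | zero =>
      intro _
      have hN0 : N ≠ 0 := by linarith [(Nat.cast_nonneg s : (0 : ℝ) ≤ s)]
      have hα0 : α 0 = 1 := by simp [hα, divCoeff]
      have hβ0 : β 0 = 1 := by simp [hβ, divCoeff]
      have h1 : N * (α 1 - β 1) = -2 := by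
        simp [hα, hβ, divCoeff]
        field_simp
        ring
      simp only [Finset.sum_range_succ, Finset.sum_range_zero, zero_add, hα0, hβ0, ← h0]
      have h2 := congrArg (· • y 0) h1
      linear_combination (norm := module) h2
    | succ m ih =>
      intro hm
      have hm' : (m : ℝ) ≤ s := by exact_mod_cast (by omega : m ≤ s)
      rw [Finset.sum_range_succ, ih (by omega)]
      have h1 := two_mul_divCoeff_succ N m (by linarith)
      have h2 := divCoeff_sub_divCoeff N m (by linarith)
      have hne : ((m : ℝ) + 1) * (N - m) ≠ 0 :=
        mul_ne_zero (Nat.cast_add_one_ne_zero m) (by linarith)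
      have h3 : α m • x m + (2 * α (m + 1)) • y (m + 1) + (α (m + 2) - β (m + 2)) • z (m + 2) =
          0 := by
        refine smul_right_injective _ hne ?_
        have e1 := congrArg (· • y (m + 1)) h1
        have e2 := congrArg (· • z (m + 2)) h2
        simp only [smul_zero] at e1 e2 ⊢
        linear_combination (norm := module) e1 + e2 + α m • h m
      linear_combination (norm := module) h3
  have h1 := key (s + 1) le_rfl
  rw [Finset.sum_range_succ, Finset.sum_range_succ, hx (s + 1) (by omega), hx (s + 2) (by omega),
    hy (s + 1) (by omega), hy (s + 2) (by omega), hz (s + 1) (by omega), hz (s + 2) (by omega),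
    Finset.sum_sub_distrib] at h1
  simpa [sub_eq_zero] using h1

section Intertwining

variable {n : ℕ} {A : Type*} [CommRing A] [Algebra ℝ A]
  (φ : MvPolynomial (Fin n) ℝ →ₐ[ℝ] Module.End ℝ A)

/-- The iterated divergences of the conformal Killing equation. -/
theorem symDiv_pow_of_symGrad (N : ℝ) (v : A ⊗[ℝ] MvPolynomial (Fin n) ℝ)
    (hv : N • symGrad φ v = symSq n A (symDiv φ v)) (j : ℕ) :
    (N - 2 * j - 2) • symGrad φ ((symDiv φ ^ (j + 1)) v) +
        ((j + 1) * (N - j)) • symLap φ ((symDiv φ ^ j) v) =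
      symSq n A ((symDiv φ ^ (j + 2)) v) := by
  have hp : ∀ i, (symDiv φ ^ (i + 1)) v = symDiv φ ((symDiv φ ^ i) v) := fun i => by
    rw [pow_succ', Module.End.mul_apply]
  induction j with
  | zero =>
    have h := congrArg (symDiv φ) hv
    rw [map_smul, symDiv_symGrad, symDiv_symSq] at h
    simp only [hp, pow_zero, Module.End.one_apply]
    push_cast
    linear_combination (norm := module) h
  | succ j ih =>
    have h := congrArg (symDiv φ) ih
    rw [map_add, map_smul, map_smul, symDiv_symGrad, symDiv_symSq, symDiv_symLap] at h
    simp only [← hp] at h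
    push_cast
    linear_combination (norm := module) h

theorem lap_quantize (hφ : ∀ a (u v : A), φ (X a) (u * v) = φ (X a) u * v + u * φ (X a) v)
    (N : ℝ) (s : ℕ) (hN : (s : ℝ) + 1 < N) (v : A ⊗[ℝ] MvPolynomial (Fin n) ℝ)
    (hv : N • symGrad φ v = symSq n A (symDiv φ v)) (hs : (symDiv φ ^ (s + 1)) v = 0) (f : A) :
    φ (∑ a, X a ^ 2) (quantize φ f
        (∑ j ∈ Finset.range (s + 1), divCoeff N (1 - N / 2) j • (symDiv φ ^ j) v)) =
      quantize φ (φ (∑ a, X a ^ 2) f)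
        (∑ j ∈ Finset.range (s + 1), divCoeff N (1 - N / 2 - 2) j • (symDiv φ ^ j) v) := by
  have hz : ∀ j, s < j → (symDiv φ ^ j) v = 0 := fun j hj => by
    obtain ⟨i, rfl⟩ := Nat.exists_eq_add_of_le' (Nat.succ_le_of_lt hj)
    rw [pow_add, Module.End.mul_apply, Nat.succ_eq_add_one, hs, map_zero]
  rw [quantize_comp_lap φ hφ, ← quantize_symSq]
  congr 1
  have := sum_divCoeff N s hN (fun j => symLap φ ((symDiv φ ^ j) v))
    (fun j => symGrad φ ((symDiv φ ^ j) v)) (fun j => symSq n A ((symDiv φ ^ j) v))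
    (by simpa using hv) (symDiv_pow_of_symGrad φ N v hv)
    (fun j hj => by simp [hz j hj]) (fun j hj => by simp [hz j hj]) (fun j hj => by simp [hz j hj])
  simp only [map_sum, map_smul]
  rw [← this, Finset.smul_sum, ← Finset.sum_add_distrib, ← Finset.sum_add_distrib]
  exact Finset.sum_congr rfl fun j _ => by module

theorem symDiv_pow_symbol_eq_zero {s : ℕ} (V : (Fin s → Fin n) → A)
    (hV : ∀ (σ : Equiv.Perm (Fin s)) b, V (b ∘ σ) = V b) :
    (symDiv φ ^ (s + 1)) (symbol V) = 0 := by
  have h := symDiv_pow_symbol φ V hV (j := s) (k := 0) rfl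
  rw [Nat.factorial_zero, Nat.cast_one, one_smul] at h
  rw [pow_succ', Module.End.mul_apply, h]
  simp [symbol]

end Intertwining

section Smooth

/-- The algebra of smooth functions on `ℝⁿ`. -/
def smoothFn (n : ℕ) : Subalgebra ℝ ((Fin n → ℝ) → ℝ) where
  carrier := {f | ContDiff ℝ ∞ f}
  mul_mem' {f g} (hf : ContDiff ℝ ∞ f) (hg : ContDiff ℝ ∞ g) := hf.mul hg
  add_mem' {f g} (hf : ContDiff ℝ ∞ f) (hg : ContDiff ℝ ∞ g) := hf.add hg
  algebraMap_mem' r := (contDiff_const : ContDiff ℝ ∞ fun _ => r)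

variable {n : ℕ}

theorem differentiableAt_smoothFn (f : smoothFn n) (x : Fin n → ℝ) :
    DifferentiableAt ℝ (f : (Fin n → ℝ) → ℝ) x :=
  (ContDiff.differentiable (n := ∞) f.2 (by simp)).differentiableAt

theorem contDiff_pd (a : Fin n) {f : (Fin n → ℝ) → ℝ} (hf : ContDiff ℝ ∞ f) :
    ContDiff ℝ ∞ (pd a f) :=
  (hf.fderiv_right (m := ∞) (by simp)).clm_apply contDiff_const

theorem pd_comm (a b : Fin n) {f : (Fin n → ℝ) → ℝ} (hf : ContDiff ℝ ∞ f) :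
    pd a (pd b f) = pd b (pd a f) := by
  have hd : Differentiable ℝ (fderiv ℝ f) :=
    (hf.fderiv_right (m := ∞) (by simp)).differentiable (by simp)
  have h : ∀ (c d : Fin n) x,
      pd c (pd d f) x = fderiv ℝ (fderiv ℝ f) x (Pi.single c 1) (Pi.single d 1) := fun c d x => by
    unfold pd
    rw [fderiv_clm_apply hd.differentiableAt (differentiableAt_const _)]
    simp
  funext x
  rw [h, h]
  exact (hf.contDiffAt.isSymmSndFDerivAt
    (by
    rw [minSmoothness_of_isRCLikeNormedField]
    exact WithTop.coe_le_coe.2 (le_top : (2 : ℕ∞) ≤ ⊤))) _ _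

/-- Partial differentiation as an endomorphism of the algebra of smooth functions. -/
noncomputable def pdEnd (a : Fin n) : Module.End ℝ (smoothFn n) where
  toFun f := ⟨pd a f, contDiff_pd a f.2⟩
  map_add' f g := Subtype.ext <| funext fun x => by
    simp [pd, fderiv_add (differentiableAt_smoothFn f x) (differentiableAt_smoothFn g x)]
  map_smul' r f := Subtype.ext <| funext fun x => by
    simp [pd, fderiv_const_smul (differentiableAt_smoothFn f x)]

@[simp] theorem coe_pdEnd (a : Fin n) (f : smoothFn n) :
    (pdEnd a f : (Fin n → ℝ) → ℝ) = pd a f := rfl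

theorem pdEnd_mul (a : Fin n) (f g : smoothFn n) :
    pdEnd a (f * g) = pdEnd a f * g + f * pdEnd a g :=
  Subtype.ext <| funext fun x => by
    simp [pd, fderiv_mul (differentiableAt_smoothFn f x) (differentiableAt_smoothFn g x)]
    ring

theorem pdEnd_comm (a b : Fin n) : pdEnd a * pdEnd b = pdEnd b * pdEnd a :=
  LinearMap.ext fun f => Subtype.ext (pd_comm a b f.2)

open scoped IsMulCommutative in
theorem exists_aeval_pdEnd (n : ℕ) : ∃ φ : MvPolynomial (Fin n) ℝ →ₐ[ℝ] Module.End ℝ (smoothFn n),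
    ∀ a, φ (X a) = pdEnd a := by
  have : IsMulCommutative (Algebra.adjoin ℝ (Set.range (pdEnd (n := n)))) :=
    Algebra.isMulCommutative_adjoin ℝ (by
      rintro _ ⟨a, rfl⟩ _ ⟨b, rfl⟩
      exact pdEnd_comm a b)
  let g : Fin n → Algebra.adjoin ℝ (Set.range (pdEnd (n := n))) :=
    fun a => ⟨pdEnd a, Algebra.subset_adjoin ⟨a, rfl⟩⟩
  exact ⟨(Algebra.adjoin ℝ _).val.comp (MvPolynomial.aeval g), fun a => by simp [g]⟩

/-- The action of constant-coefficient differential operators on smooth functions. -/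
noncomputable def diffOp (n : ℕ) : MvPolynomial (Fin n) ℝ →ₐ[ℝ] Module.End ℝ (smoothFn n) :=
  (exists_aeval_pdEnd n).choose

@[simp] theorem diffOp_X (a : Fin n) : diffOp n (X a) = pdEnd a :=
  (exists_aeval_pdEnd n).choose_spec a

theorem coe_diffOp_prod {m : ℕ} (a : Fin m → Fin n) (f : smoothFn n) :
    (diffOp n (∏ i, X (a i)) f : (Fin n → ℝ) → ℝ) = pds a f := by
  induction m with
  | zero => simp [pds]
  | succ m ih =>
    rw [Fin.prod_univ_succ, map_mul, Module.End.mul_apply, diffOp_X, coe_pdEnd, ih, pds]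

theorem coe_diffOp_lap (f : smoothFn n) :
    (diffOp n (∑ a, X a ^ 2) f : (Fin n → ℝ) → ℝ) = lap f := by
  funext x
  simp [lap, pow_two, LinearMap.sum_apply]

theorem divCoeff_mul_factorial (s : ℕ) (w : ℝ) {k : ℕ} (hk : k ≤ s) :
    divCoeff ((n : ℝ) + 2 * s - 2) (w - s + 1) (s - k) * s.factorial =
      k.factorial * coeffC n s w k := by
  have h : (s.choose k : ℝ) * k.factorial * (s - k).factorial = s.factorial := by
    exact_mod_cast Nat.choose_mul_factorial_mul_factorial hk
  have hf : ((s - k).factorial : ℝ) ≠ 0 := Nat.cast_ne_zero.2 (s - k).factorial_ne_zero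
  rw [divCoeff, coeffC, ← h]
  field_simp

theorem opDw_eq_quantize {s : ℕ} (V : (Fin s → Fin n) → smoothFn n)
    (hV : ∀ (σ : Equiv.Perm (Fin s)) b, V (b ∘ σ) = V b) (w : ℝ) (f : smoothFn n) :
    opDw n s w (fun x b => (V b : (Fin n → ℝ) → ℝ) x) f =
      (quantize (diffOp n) f (∑ j ∈ Finset.range (s + 1),
        divCoeff ((n : ℝ) + 2 * s - 2) (w - s + 1) j • (symDiv (diffOp n) ^ j) (symbol V)) :
        (Fin n → ℝ) → ℝ) := by
  have h : ∀ k ∈ Finset.range (s + 1),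
      divCoeff ((n : ℝ) + 2 * s - 2) (w - s + 1) (s + 1 - 1 - k) •
          (symDiv (diffOp n) ^ (s + 1 - 1 - k)) (symbol V) =
        coeffC n s w k • symbol fun b : Fin k → Fin n => ∑ a : Fin (s - k) → Fin n,
          diffOp n (∏ i, X (a i)) (V (glue (by omega) a b)) := fun k hk => by
    have hks : k ≤ s := Nat.lt_succ_iff.1 (Finset.mem_range.1 hk)
    refine smul_right_injective _
      (Nat.cast_ne_zero.2 k.factorial_ne_zero : (k.factorial : ℝ) ≠ 0) ?_
    simp only [Nat.add_sub_cancel]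
    rw [smul_comm, symDiv_pow_symbol (diffOp n) V hV (Nat.sub_add_cancel hks).symm, smul_smul,
      smul_smul, divCoeff_mul_factorial s w hks]
  rw [← Finset.sum_range_reflect, Finset.sum_congr rfl h]
  funext x
  simp only [opDw, symbol, map_sum, map_smul, quantize_tmul, AddSubmonoidClass.coe_finsetSum,
    Finset.sum_apply, Subalgebra.coe_smul, Pi.smul_apply, smul_eq_mul, Subalgebra.coe_mul,
    Pi.mul_apply, coe_diffOp_prod, Finset.sum_mul]
  refine Finset.sum_congr rfl fun k _ => ?_
  rw [Finset.sum_comm]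
  rfl

theorem symGrad_symbol_of_isCKT {m : ℕ} (hn : 3 ≤ n) {V : (Fin n → ℝ) → (Fin (m + 1) → Fin n) → ℝ}
    (hV : IsCKT n (m + 1) V) :
    ((n : ℝ) + 2 * (m + 1 : ℕ) - 2) •
        symGrad (diffOp n) (symbol fun b => (⟨fun x => V x b, hV.1.1 b⟩ : smoothFn n)) =
      symSq n _ (symDiv (diffOp n) (symbol fun b => ⟨fun x => V x b, hV.1.1 b⟩)) := by
  have hn' : (3 : ℝ) ≤ n := by exact_mod_cast hn
  have hm : (0 : ℝ) ≤ m := Nat.cast_nonneg m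
  refine symGrad_symbol_of_ckt (diffOp n) _
    (fun σ b => Subtype.ext (funext fun x => hV.1.2.1 x σ b)) _ (by push_cast; linarith) fun c => ?_
  refine Subtype.ext (funext fun x => ?_)
  have h := hV.2 x c
  have hd : ∀ σ : Equiv.Perm (Fin (m + 2)),
      divT n (m + 1) V x (fun i => c (σ ⟨(i : ℕ) + 2, by have := i.isLt; omega⟩)) =
        ∑ e, pd e (fun y => V y (Fin.cons e fun i => c (σ i.succ.succ))) x := fun σ => by
    refine Finset.sum_congr rfl fun e _ => ?_
    congr 2
    funext y
    congr 1
    funext j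
    refine Fin.cases rfl (fun i => ?_) j
    rfl
  simp only [hd] at h
  simpa [apply_ite Subtype.val, ite_apply] using h

end Smooth

end ConformalSymbol

/-- For a conformal Killing `s`-tensor `V` on ℝⁿ (n ≥ 3, s ≥ 1), with `w₁ = 1 − n/2` and
`w₂ = −1 − n/2`, one has `Δ(D_V^{(w₁)} f) = D_V^{(w₂)}(Δ f)` for every smooth `f`;
in particular `D_V^{(1−n/2)}` maps harmonic functions to harmonic functions. -/
theorem stmt_2 (n s : ℕ) (hn : 3 ≤ n) (hs : 1 ≤ s)
    (V : (Fin n → ℝ) → (Fin s → Fin n) → ℝ) (hV : IsCKT n s V)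
    (f : (Fin n → ℝ) → ℝ) (hf : ContDiff ℝ (⊤ : ℕ∞) f) :
    lap (opDw n s (1 - n / 2) V f) = opDw n s (-1 - n / 2) V (lap f) ∧
      (lap f = 0 → lap (opDw n s (1 - n / 2) V f) = 0) := by
  obtain ⟨m, rfl⟩ := Nat.exists_eq_add_of_le' hs
  have hn' : (3 : ℝ) ≤ n := by exact_mod_cast hn
  have hm : (0 : ℝ) ≤ m := Nat.cast_nonneg m
  let V' : (Fin (m + 1) → Fin n) → ConformalSymbol.smoothFn n :=
    fun b => ⟨fun x => V x b, hV.1.1 b⟩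
  let f' : ConformalSymbol.smoothFn n := ⟨f, hf⟩
  have hV' : ∀ (σ : Equiv.Perm (Fin (m + 1))) b, V' (b ∘ σ) = V' b :=
    fun σ b => Subtype.ext (funext fun x => hV.1.2.1 x σ b)
  have hD : ∀ (w : ℝ) (g : ConformalSymbol.smoothFn n), opDw n (m + 1) w V g = _ :=
    ConformalSymbol.opDw_eq_quantize V' hV'
  have hL : (ConformalSymbol.diffOp n (∑ a, MvPolynomial.X a ^ 2) f' : (Fin n → ℝ) → ℝ) = lap f :=
    ConformalSymbol.coe_diffOp_lap f'
  have main : lap (opDw n (m + 1) (1 - n / 2) V f) = opDw n (m + 1) (-1 - n / 2) V (lap f) := by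
    rw [← hL, hD, show opDw n (m + 1) (1 - n / 2) V f = _ from hD _ f',
      ← ConformalSymbol.coe_diffOp_lap]
    have h := ConformalSymbol.lap_quantize (ConformalSymbol.diffOp n)
      (fun a u v => by simpa using ConformalSymbol.pdEnd_mul a u v)
      ((n : ℝ) + 2 * (m + 1 : ℕ) - 2) (m + 1) (by push_cast; linarith)
      (ConformalSymbol.symbol V') (ConformalSymbol.symGrad_symbol_of_isCKT hn hV)
      (ConformalSymbol.symDiv_pow_symbol_eq_zero _ V' hV') f'
    rw [show (1 : ℝ) - n / 2 - (m + 1 : ℕ) + 1 = 1 - ((n : ℝ) + 2 * (m + 1 : ℕ) - 2) / 2 by ring,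
      show (-1 : ℝ) - n / 2 - (m + 1 : ℕ) + 1 =
        1 - ((n : ℝ) + 2 * (m + 1 : ℕ) - 2) / 2 - 2 by ring, h]
  refine ⟨main, fun hf0 => ?_⟩
  have h0 : ConformalSymbol.quantize (ConformalSymbol.diffOp n) 0 = 0 :=
    TensorProduct.ext' fun u p => by simp
  rw [main, hf0]
  simpa [h0] using hD (-1 - n / 2) 0
end

section
/- Let n ≥ 3 and s ≥ 1. Let D be a linear differential operator of order s on ℝⁿ of the form D f = Σ_{b₁,…,b_s} V^{b₁⋯b_s} ∂_{b₁} ⋯ ∂_{b_s} f + Σ_{k=0}^{s−1} Σ_{b₁,…,b_k} A_k^{b₁⋯b_k} ∂_{b₁} ⋯ ∂_{b_k} f, where the symbol V is a smooth field of symmetric trace-free s-tensors on ℝⁿ and the A_k are smooth tensor fields. Suppose D is a symmetry of the Laplacian in the sense that there exist t ≥ 0 and smooth tensor fields B_k (0 ≤ k ≤ t) such that Δ(D f) = Σ_{k=0}^{t} Σ_{b₁,…,b_k} B_k^{b₁⋯b_k} ∂_{b₁} ⋯ ∂_{b_k} (Δ f) for all smooth f : ℝⁿ → ℝ. Then V is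 a conformal Killing s-tensor. -/
open MvPolynomial

section Algebra

variable {n : ℕ}

/-- The polynomial `Σ_c U(c) X_{c₁} ⋯ X_{c_m}` of a tensor `U` of rank `m`. -/
noncomputable def tensorPoly {m : ℕ} :
    ((Fin m → Fin n) → ℝ) →ₗ[ℝ] MvPolynomial (Fin n) ℝ :=
  ∑ c : Fin m → Fin n, (LinearMap.proj c).smulRight (∏ i, X (c i))

/-- Iterated formal partial derivatives of a polynomial. -/
noncomputable def pderivs : {m : ℕ} → (Fin m → Fin n) →
    MvPolynomial (Fin n) ℝ →ₗ[ℝ] MvPolynomial (Fin n) ℝ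
  | 0, _ => LinearMap.id
  | _ + 1, c => (pderiv (c 0)).toLinearMap ∘ₗ pderivs (fun i => c i.succ)

/-- The formal Laplacian of a polynomial. -/
noncomputable def polyLap : MvPolynomial (Fin n) ℝ →ₗ[ℝ] MvPolynomial (Fin n) ℝ :=
  ∑ a, (pderiv a).toLinearMap ∘ₗ (pderiv a).toLinearMap

/-- Invariance of a tensor under permutations of its indices. -/
def IsSymTensor {m : ℕ} (U : (Fin m → Fin n) → ℝ) : Prop :=
  ∀ (σ : Equiv.Perm (Fin m)) (c : Fin m → Fin n), U (c ∘ σ) = U c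

/-- The unnormalized symmetrization of a tensor. -/
def symTensor {m : ℕ} (U : (Fin m → Fin n) → ℝ) (c : Fin m → Fin n) : ℝ :=
  ∑ σ : Equiv.Perm (Fin m), U (c ∘ σ)

lemma tensorPoly_apply {m : ℕ} (U : (Fin m → Fin n) → ℝ) :
    tensorPoly U = ∑ c, U c • ∏ i, (X (c i) : MvPolynomial (Fin n) ℝ) := by
  simp [tensorPoly]

lemma polyLap_apply (p : MvPolynomial (Fin n) ℝ) :
    polyLap p = ∑ a, pderiv a (pderiv a p) := by
  simp [polyLap]

lemma pderivs_zero (c : Fin 0 → Fin n) (p : MvPolynomial (Fin n) ℝ) : pderivs c p = p := rfl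

lemma pderivs_succ {m : ℕ} (c : Fin (m + 1) → Fin n) (p : MvPolynomial (Fin n) ℝ) :
    pderivs c p = pderiv (c 0) (pderivs (fun i => c i.succ) p) := rfl

lemma pderivs_cons {m : ℕ} (a : Fin n) (c : Fin m → Fin n) (p : MvPolynomial (Fin n) ℝ) :
    pderivs (Fin.cons a c : Fin (m + 1) → Fin n) p = pderiv a (pderivs c p) := rfl

lemma sum_fin_succ_fun {M : Type*} [AddCommMonoid M] {m : ℕ}
    (F : (Fin (m + 1) → Fin n) → M) :
    ∑ c, F c = ∑ a, ∑ c : Fin m → Fin n, F (Fin.cons a c) := by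
  rw [← Fintype.sum_prod_type']
  exact (Fintype.sum_equiv (Fin.consEquiv (fun _ => Fin n)) _ _ fun _ => rfl).symm

lemma tensorPoly_succ {m : ℕ} (U : (Fin (m + 1) → Fin n) → ℝ) :
    tensorPoly U = ∑ a, X a * tensorPoly (fun c => U (Fin.cons a c)) := by
  simp only [tensorPoly_apply, sum_fin_succ_fun, Fin.prod_univ_succ, Fin.cons_zero,
    Fin.cons_succ, Finset.mul_sum, mul_smul_comm]

lemma pderiv_pderiv_comm (a b : Fin n) (p : MvPolynomial (Fin n) ℝ) :
    pderiv a (pderiv b p) = pderiv b (pderiv a p) := by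
  classical
  induction p using MvPolynomial.induction_on with
  | C r => simp
  | add p q hp hq => simp only [map_add, hp, hq]
  | mul_X p i hp =>
    simp only [Derivation.leibniz, map_add, hp, pderiv_X, Pi.single_apply, smul_eq_mul, mul_ite,
      mul_one, mul_zero, apply_ite (pderiv _), map_zero]
    split_ifs <;> (try simp) <;> ring

lemma pderiv_pderivs_comm {m : ℕ} (a : Fin n) (c : Fin m → Fin n) (p : MvPolynomial (Fin n) ℝ) :
    pderiv a (pderivs c p) = pderivs c (pderiv a p) := by
  induction m with
  | zero => rfl
  | succ m ih => rw [pderivs_succ, pderivs_succ, pderiv_pderiv_comm, ih]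

lemma polyLap_pderivs_comm {m : ℕ} (c : Fin m → Fin n) (p : MvPolynomial (Fin n) ℝ) :
    polyLap (pderivs c p) = pderivs c (polyLap p) := by
  simp only [polyLap_apply, pderiv_pderivs_comm, map_sum]

lemma IsSymTensor.cons {m : ℕ} {U : (Fin (m + 1) → Fin n) → ℝ} (hU : IsSymTensor U)
    (a : Fin n) : IsSymTensor fun c => U (Fin.cons a c) := by
  intro σ c
  change U (Fin.cons a (c ∘ σ)) = U (Fin.cons a c)
  rw [← hU (Equiv.Perm.decomposeFin.symm (0, σ)) (Fin.cons a c)]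
  congr 1
  funext i
  cases i using Fin.cases <;> simp

lemma IsSymTensor.swap {m : ℕ} {U : (Fin (m + 2) → Fin n) → ℝ} (hU : IsSymTensor U)
    (a b : Fin n) (c : Fin m → Fin n) :
    U (Fin.cons a (Fin.cons b c : Fin (m + 1) → Fin n)) =
      U (Fin.cons b (Fin.cons a c : Fin (m + 1) → Fin n)) := by
  rw [← hU (Equiv.swap 0 1)]
  congr 1
  funext i
  refine Fin.cases ?_ (fun i => Fin.cases ?_ (fun i => ?_) i) i
  · simp
  · simp
  · rw [Function.comp_apply, Equiv.swap_apply_of_ne_of_ne (by simp [Fin.ext_iff])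
      (by simp [Fin.ext_iff])]
    simp

lemma isSymTensor_symTensor {m : ℕ} (U : (Fin m → Fin n) → ℝ) : IsSymTensor (symTensor U) := by
  intro σ c
  exact Fintype.sum_equiv (Equiv.mulLeft σ) _ _ fun τ => rfl

lemma sum_comp_perm {M : Type*} [AddCommMonoid M] {m : ℕ} (σ : Equiv.Perm (Fin m))
    (F : (Fin m → Fin n) → M) : ∑ c, F (c ∘ σ) = ∑ c, F c :=
  Fintype.sum_equiv (Equiv.arrowCongr σ.symm (Equiv.refl _)) _ _ fun _ => rfl

lemma tensorPoly_symTensor {m : ℕ} (U : (Fin m → Fin n) → ℝ) :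
    tensorPoly (symTensor U) = (m.factorial : ℝ) • tensorPoly U := by
  have h (σ : Equiv.Perm (Fin m)) :
      ∑ c : Fin m → Fin n, U (c ∘ σ) • ∏ i, (X (c i) : MvPolynomial (Fin n) ℝ) =
        tensorPoly U := by
    rw [tensorPoly_apply,
      ← sum_comp_perm σ fun c => U c • ∏ i, (X (c i) : MvPolynomial (Fin n) ℝ)]
    refine Finset.sum_congr rfl fun c _ => ?_
    exact congrArg _ (Equiv.prod_comp σ fun i => X (c i)).symm
  rw [tensorPoly_apply]
  simp only [symTensor, Finset.sum_smul]
  rw [Finset.sum_comm, Finset.sum_congr rfl fun σ _ => h σ]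
  simp [Fintype.card_perm, Nat.cast_smul_eq_nsmul]

lemma sum_mul_symTensor {m : ℕ} (U : (Fin m → Fin n) → ℝ) :
    (m.factorial : ℝ) * ∑ c, U c * symTensor U c = ∑ c, symTensor U c ^ 2 := by
  have h (σ : Equiv.Perm (Fin m)) :
      ∑ c, U (c ∘ σ) * symTensor U c = ∑ c, U c * symTensor U c := by
    rw [← sum_comp_perm σ fun c => U c * symTensor U c]
    simp only [isSymTensor_symTensor U σ]
  have h2 : ∑ c, symTensor U c ^ 2 = ∑ σ : Equiv.Perm (Fin m), ∑ c, U (c ∘ σ) * symTensor U c := by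
    rw [Finset.sum_comm]
    simp only [← Finset.sum_mul, pow_two]
    rfl
  rw [h2, Finset.sum_congr rfl fun σ _ => h σ]
  simp [Fintype.card_perm]

lemma pderiv_tensorPoly {m : ℕ} {U : (Fin (m + 1) → Fin n) → ℝ} (hU : IsSymTensor U)
    (a : Fin n) :
    pderiv a (tensorPoly U) = ((m : ℝ) + 1) • tensorPoly fun c => U (Fin.cons a c) := by
  classical
  induction m with
  | zero =>
    rw [tensorPoly_succ]
    simp [tensorPoly_apply, pderiv_X, Pi.single_apply]
  | succ m ih =>
    rw [tensorPoly_succ, map_sum]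
    simp only [Derivation.leibniz, ih (hU.cons _), pderiv_X, Pi.single_apply, smul_eq_mul,
      Finset.sum_add_distrib, mul_ite, mul_one, mul_zero, Finset.sum_ite_eq',
      Finset.mem_univ, if_true, hU.swap _ a, mul_smul_comm, ← Finset.smul_sum]
    rw [← tensorPoly_succ fun c => U (Fin.cons a c)]
    push_cast
    module

lemma pderivs_tensorPoly {m : ℕ} {U : (Fin m → Fin n) → ℝ} (hU : IsSymTensor U)
    (c : Fin m → Fin n) : pderivs c (tensorPoly U) = C (m.factorial * U c) := by
  induction m with
  | zero =>
    rw [pderivs_zero, tensorPoly_apply, Fintype.sum_unique]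
    simp [smul_eq_C_mul, Subsingleton.elim default c]
  | succ m ih =>
    rw [pderivs_succ, pderiv_pderivs_comm, pderiv_tensorPoly hU, map_smul, ih (hU.cons _),
      smul_eq_C_mul, ← C_mul, Nat.factorial_succ]
    rw [show Fin.cons (c 0) (fun i => c i.succ) = c from Fin.cons_self_tail c]
    push_cast
    rw [mul_assoc]

lemma eval_zero_pderivs_tensorPoly {m k : ℕ} {U : (Fin m → Fin n) → ℝ} (hU : IsSymTensor U)
    (hk : k < m) (c : Fin k → Fin n) : eval 0 (pderivs c (tensorPoly U)) = 0 := by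
  obtain ⟨m, rfl⟩ : ∃ l, m = l + 1 := ⟨m - 1, by omega⟩
  induction k generalizing m with
  | zero => simp [pderivs_zero, tensorPoly_succ]
  | succ k ih =>
    obtain ⟨m, rfl⟩ : ∃ l, m = l + 1 := ⟨m - 1, by omega⟩
    rw [pderivs_succ, pderiv_pderivs_comm, pderiv_tensorPoly hU, map_smul, smul_eval,
      ih _ _ (hU.cons _) (by omega), mul_zero]

lemma polyLap_tensorPoly_eq_zero {m : ℕ} {U : (Fin m → Fin n) → ℝ} (hU : IsSymTensor U)
    (htr : ∀ i j : Fin m, i ≠ j → ∀ c : Fin m → Fin n,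
      ∑ e, U (Function.update (Function.update c i e) j e) = 0) :
    polyLap (tensorPoly U) = 0 := by
  rw [polyLap_apply]
  match m with
  | 0 => simp [tensorPoly_apply, smul_eq_C_mul]
  | 1 =>
    simp only [pderiv_tensorPoly hU]
    simp [tensorPoly_apply, smul_eq_C_mul]
  | m + 2 =>
    simp only [pderiv_tensorPoly hU, Derivation.map_smul, pderiv_tensorPoly (hU.cons _),
      ← Finset.smul_sum, ← map_sum]
    have h0 : (∑ e, fun c : Fin m → Fin n =>
        U (Fin.cons e (Fin.cons e c : Fin (m + 1) → Fin n))) = 0 := by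
      funext c
      rcases isEmpty_or_nonempty (Fin n) with _ | ⟨⟨d⟩⟩
      · simp
      rw [Finset.sum_apply, Pi.zero_apply, ← htr 0 1 (by simp)
        (Fin.cons d (Fin.cons d c : Fin (m + 1) → Fin n))]
      refine Finset.sum_congr rfl fun e _ => congrArg U ?_
      funext i
      refine Fin.cases ?_ (fun i => Fin.cases ?_ (fun i => ?_) i) i
      · simp
      · simp
      · simp [Fin.ext_iff]
    rw [h0]
    simp

lemma polyLap_mul (p q : MvPolynomial (Fin n) ℝ) :
    polyLap (p * q) = polyLap p * q + 2 * ∑ a, pderiv a p * pderiv a q + p * polyLap q := by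
  simp only [polyLap_apply, Derivation.leibniz, map_add, smul_eq_mul, Finset.sum_add_distrib,
    Finset.sum_mul, Finset.mul_sum]
  simp only [← Finset.sum_add_distrib]
  refine Finset.sum_congr rfl fun a _ => ?_
  ring

lemma polyLap_sum_X_mul (u : Fin n → MvPolynomial (Fin n) ℝ) (hu : ∀ a, polyLap (u a) = 0) :
    polyLap (∑ a, X a * u a) = 2 * ∑ a, pderiv a (u a) := by
  classical
  rw [map_sum, Finset.mul_sum]
  refine Finset.sum_congr rfl fun a _ => ?_
  rw [polyLap_mul, hu, polyLap_apply]
  simp [pderiv_X, Pi.single_apply, apply_ite]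

lemma sum_X_mul_pderiv_tensorPoly {m : ℕ} {U : (Fin m → Fin n) → ℝ} (hU : IsSymTensor U) :
    ∑ a, X a * pderiv a (tensorPoly U) = (m : ℝ) • tensorPoly U := by
  cases m with
  | zero => simp [tensorPoly_apply, smul_eq_C_mul]
  | succ m =>
    simp only [pderiv_tensorPoly hU, mul_smul_comm, ← Finset.smul_sum, ← tensorPoly_succ]
    push_cast
    rfl

lemma polyLap_sq_mul_tensorPoly {m : ℕ} {U : (Fin m → Fin n) → ℝ} (hU : IsSymTensor U)
    (h0 : polyLap (tensorPoly U) = 0) :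
    polyLap ((∑ a, X a * X a) * tensorPoly U) = (2 * n + 4 * m : ℝ) • tensorPoly U := by
  classical
  have h1 (a : Fin n) :
      pderiv a (∑ b, X b * X b : MvPolynomial (Fin n) ℝ) = (2 : ℝ) • X a := by
    simp [pderiv_X, Pi.single_apply, ← two_mul, two_smul]
  have h2 : polyLap (∑ b, X b * X b : MvPolynomial (Fin n) ℝ) = C (2 * n : ℝ) := by
    rw [polyLap_apply]
    simp only [h1]
    simp [smul_eq_C_mul, mul_comm]
  rw [polyLap_mul, h0, h2]
  simp only [h1, smul_mul_assoc, ← Finset.smul_sum, sum_X_mul_pderiv_tensorPoly hU]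
  rw [← smul_eq_C_mul, mul_zero, add_zero, show (2 : MvPolynomial (Fin n) ℝ) = C 2 from rfl,
    ← smul_eq_C_mul]
  module

end Algebra

section Analysis

variable {n : ℕ}

lemma contDiff_pd {f : (Fin n → ℝ) → ℝ} (hf : ContDiff ℝ (⊤ : ℕ∞) f) (a : Fin n) :
    ContDiff ℝ (⊤ : ℕ∞) (pd a f) :=
  (hf.fderiv_right (m := (⊤ : ℕ∞)) (by simp)).clm_apply contDiff_const

lemma pd_mul {f g : (Fin n → ℝ) → ℝ} (hf : ContDiff ℝ (⊤ : ℕ∞) f)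
    (hg : ContDiff ℝ (⊤ : ℕ∞) g) (a : Fin n) :
    pd a (fun x => f x * g x) = fun x => pd a f x * g x + f x * pd a g x := by
  funext x
  simp only [pd]
  rw [fderiv_fun_mul (hf.differentiable (by simp) x) (hg.differentiable (by simp) x)]
  simp [add_comm, mul_comm]

lemma pd_add {f g : (Fin n → ℝ) → ℝ} (hf : ContDiff ℝ (⊤ : ℕ∞) f)
    (hg : ContDiff ℝ (⊤ : ℕ∞) g) (a : Fin n) :
    pd a (fun x => f x + g x) = fun x => pd a f x + pd a g x := by
  funext x
  simp only [pd]
  rw [fderiv_fun_add (hf.differentiable (by simp) x) (hg.differentiable (by simp) x)]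
  simp

lemma pd_sum {ι : Type*} (s : Finset ι) {f : ι → (Fin n → ℝ) → ℝ}
    (hf : ∀ i, ContDiff ℝ (⊤ : ℕ∞) (f i)) (a : Fin n) :
    pd a (fun x => ∑ i ∈ s, f i x) = fun x => ∑ i ∈ s, pd a (f i) x := by
  funext x
  simp only [pd]
  rw [fderiv_fun_sum fun i _ => (hf i).differentiable (by simp) x]
  simp

lemma lap_add {f g : (Fin n → ℝ) → ℝ} (hf : ContDiff ℝ (⊤ : ℕ∞) f)
    (hg : ContDiff ℝ (⊤ : ℕ∞) g) (x : Fin n → ℝ) :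
    lap (fun x => f x + g x) x = lap f x + lap g x := by
  simp only [lap, pd_add hf hg, pd_add (contDiff_pd hf _) (contDiff_pd hg _),
    Finset.sum_add_distrib]

lemma lap_sum {ι : Type*} (s : Finset ι) {f : ι → (Fin n → ℝ) → ℝ}
    (hf : ∀ i, ContDiff ℝ (⊤ : ℕ∞) (f i)) (x : Fin n → ℝ) :
    lap (fun x => ∑ i ∈ s, f i x) x = ∑ i ∈ s, lap (f i) x := by
  simp only [lap, pd_sum s hf, pd_sum s fun i => contDiff_pd (hf i) _]
  exact Finset.sum_comm

lemma lap_mul {f g : (Fin n → ℝ) → ℝ} (hf : ContDiff ℝ (⊤ : ℕ∞) f)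
    (hg : ContDiff ℝ (⊤ : ℕ∞) g) (x : Fin n → ℝ) :
    lap (fun x => f x * g x) x =
      lap f x * g x + 2 * ∑ a, pd a f x * pd a g x + f x * lap g x := by
  simp only [lap, pd_mul hf hg, Finset.sum_mul, Finset.mul_sum, ← Finset.sum_add_distrib]
  refine Finset.sum_congr rfl fun a _ => ?_
  rw [pd_add ((contDiff_pd hf a).mul hg) (hf.mul (contDiff_pd hg a)),
    pd_mul (contDiff_pd hf a) hg, pd_mul hf (contDiff_pd hg a)]
  ring

/-- The polynomial function `x ↦ p(x - x₀)`. -/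
noncomputable def polyFun (x₀ : Fin n → ℝ) (p : MvPolynomial (Fin n) ℝ) (x : Fin n → ℝ) : ℝ :=
  eval (x - x₀) p

lemma contDiff_polyFun (x₀ : Fin n → ℝ) (p : MvPolynomial (Fin n) ℝ) :
    ContDiff ℝ (⊤ : ℕ∞) (polyFun x₀ p) := by
  unfold polyFun
  induction p using MvPolynomial.induction_on with
  | C r => simpa using contDiff_const
  | add p q hp hq => simpa using hp.add hq
  | mul_X p i hp =>
    simp only [map_mul, eval_X, Pi.sub_apply]
    fun_prop

lemma pd_polyFun (x₀ : Fin n → ℝ) (a : Fin n) (p : MvPolynomial (Fin n) ℝ) :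
    pd a (polyFun x₀ p) = polyFun x₀ (pderiv a p) := by
  classical
  induction p using MvPolynomial.induction_on with
  | C r =>
    have h : polyFun x₀ (C r) = fun _ => r := by
      funext x
      simp [polyFun]
    funext x
    simp [h, polyFun, pd]
  | add p q hp hq =>
    have h : polyFun x₀ (p + q) = fun x => polyFun x₀ p x + polyFun x₀ q x := by
      funext x
      simp [polyFun]
    rw [h, pd_add (contDiff_polyFun x₀ p) (contDiff_polyFun x₀ q), hp, hq]
    funext x
    simp [polyFun]
  | mul_X p i hp =>
    have h : polyFun x₀ (p * X i) = fun x => polyFun x₀ p x * polyFun x₀ (X i) x := by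
      funext x
      simp [polyFun]
    have hX : pd a (polyFun x₀ (X i)) = polyFun x₀ (pderiv a (X i)) := by
      funext x
      have hd : HasFDerivAt (fun y : Fin n → ℝ => y i - x₀ i)
          (ContinuousLinearMap.proj (R := ℝ) (φ := fun _ : Fin n => ℝ) i) x :=
        (ContinuousLinearMap.proj (R := ℝ) (φ := fun _ : Fin n => ℝ) i).hasFDerivAt.sub_const _
      have he : polyFun x₀ (X i) = fun y : Fin n → ℝ => y i - x₀ i := by
        funext y
        simp [polyFun]
      simp only [pd]
      rw [he, hd.fderiv]
      simp [polyFun, pderiv_X, Pi.single_apply, apply_ite, eq_comm]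
    rw [h, pd_mul (contDiff_polyFun x₀ p) (contDiff_polyFun x₀ _), hp, hX]
    funext x
    simp only [polyFun, Derivation.leibniz, smul_eq_mul, map_add, map_mul]
    ring

lemma pds_polyFun {m : ℕ} (x₀ : Fin n → ℝ) (c : Fin m → Fin n) (p : MvPolynomial (Fin n) ℝ) :
    pds c (polyFun x₀ p) = polyFun x₀ (pderivs c p) := by
  induction m with
  | zero => rfl
  | succ m ih =>
    change pd (c 0) (pds _ _) = _
    rw [ih, pd_polyFun]
    rfl

lemma lap_polyFun (x₀ : Fin n → ℝ) (p : MvPolynomial (Fin n) ℝ) :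
    lap (polyFun x₀ p) = polyFun x₀ (polyLap p) := by
  funext x
  simp [lap, pd_polyFun, polyLap_apply, polyFun]

lemma lap_mul_polyFun {g : (Fin n → ℝ) → ℝ} (hg : ContDiff ℝ (⊤ : ℕ∞) g)
    {p : MvPolynomial (Fin n) ℝ} (hp : polyLap p = 0) (x₀ : Fin n → ℝ) :
    lap (fun x => g x * polyFun x₀ p x) x₀ =
      lap g x₀ * eval 0 p + 2 * ∑ a, pd a g x₀ * eval 0 (pderiv a p) := by
  rw [lap_mul hg (contDiff_polyFun x₀ p), lap_polyFun, hp]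
  simp [pd_polyFun, polyFun]

lemma sum_pd_symbol_mul_eq_zero {s : ℕ}
    {V : (Fin n → ℝ) → (Fin s → Fin n) → ℝ} (hV : ∀ b, ContDiff ℝ (⊤ : ℕ∞) fun x => V x b)
    {A : (k : Fin s) → (Fin n → ℝ) → (Fin (k : ℕ) → Fin n) → ℝ}
    (hA : ∀ (k : Fin s) (b : Fin (k : ℕ) → Fin n), ContDiff ℝ (⊤ : ℕ∞) fun x => A k x b)
    {t : ℕ} {B : (k : Fin (t + 1)) → (Fin n → ℝ) → (Fin (k : ℕ) → Fin n) → ℝ}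
    (hsym : ∀ f : (Fin n → ℝ) → ℝ, ContDiff ℝ (⊤ : ℕ∞) f →
      lap (fun x => (∑ b : Fin s → Fin n, V x b * pds b f x)
          + ∑ k : Fin s, ∑ b : Fin (k : ℕ) → Fin n, A k x b * pds b f x)
        = fun x => ∑ k : Fin (t + 1), ∑ b : Fin (k : ℕ) → Fin n,
            B k x b * pds b (lap f) x)
    (x₀ : Fin n → ℝ) {T : (Fin (s + 1) → Fin n) → ℝ} (hT : IsSymTensor T)
    (hT0 : polyLap (tensorPoly T) = 0) :
    ∑ c : Fin (s + 1) → Fin n, pd (c 0) (fun y => V y fun i => c i.succ) x₀ * T c = 0 := by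
  have hlap {k : ℕ} (b : Fin k → Fin n) : polyLap (pderivs b (tensorPoly T)) = 0 := by
    rw [polyLap_pderivs_comm, hT0, map_zero]
  have h := congrFun (hsym _ (contDiff_polyFun x₀ (tensorPoly T))) x₀
  have h0 (x : Fin n → ℝ) : polyFun x₀ 0 x = 0 := by simp [polyFun]
  simp only [lap_polyFun, hT0, pds_polyFun, map_zero, h0, mul_zero, Finset.sum_const_zero] at h
  have hVp (b : Fin s → Fin n) : ContDiff ℝ (⊤ : ℕ∞)
      fun x => V x b * polyFun x₀ (pderivs b (tensorPoly T)) x :=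
    (hV b).mul (contDiff_polyFun _ _)
  have hAp (k : Fin s) (b : Fin (k : ℕ) → Fin n) : ContDiff ℝ (⊤ : ℕ∞)
      fun x => A k x b * polyFun x₀ (pderivs b (tensorPoly T)) x :=
    (hA k b).mul (contDiff_polyFun _ _)
  rw [lap_add (ContDiff.sum fun b _ => hVp b)
      (ContDiff.sum fun k _ => ContDiff.sum fun b _ => hAp k b),
    lap_sum _ hVp, lap_sum _ fun k => ContDiff.sum fun b _ => hAp k b] at h
  have hA0 (k : Fin s) :
      lap (fun x => ∑ b, A k x b * polyFun x₀ (pderivs b (tensorPoly T)) x) x₀ = 0 := by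
    rw [lap_sum _ (hAp k)]
    refine Finset.sum_eq_zero fun b _ => ?_
    rw [lap_mul_polyFun (hA k b) (hlap b),
      eval_zero_pderivs_tensorPoly hT (k.isLt.trans s.lt_succ_self)]
    simp only [← pderivs_cons, eval_zero_pderivs_tensorPoly hT (Nat.succ_lt_succ k.isLt),
      mul_zero, Finset.sum_const_zero, add_zero]
  have hV0 (b : Fin s → Fin n) :
      lap (fun x => V x b * polyFun x₀ (pderivs b (tensorPoly T)) x) x₀ =
        2 * (s + 1).factorial * ∑ a, pd a (fun x => V x b) x₀ * T (Fin.cons a b) := by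
    rw [lap_mul_polyFun (hV b) (hlap b), eval_zero_pderivs_tensorPoly hT s.lt_succ_self]
    simp only [← pderivs_cons, pderivs_tensorPoly hT, eval_C, Finset.mul_sum]
    rw [mul_zero, zero_add]
    exact Finset.sum_congr rfl fun a _ => by ring
  simp only [hA0, hV0, Finset.sum_const_zero, add_zero, ← Finset.mul_sum] at h
  rw [sum_fin_succ_fun, Finset.sum_comm]
  simpa [Nat.factorial_ne_zero] using h

end Analysis

/-- If the order-`s` operator `D f = Σ_b V^{b₁⋯b_s} ∂_{b₁}⋯∂_{b_s} f + lower order terms`,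
whose symbol `V` is a smooth symmetric trace-free `s`-tensor field, is a symmetry of the
Laplacian on ℝⁿ (n ≥ 3), i.e. `Δ∘D = δ∘Δ` for some linear differential operator `δ`,
then `V` is a conformal Killing `s`-tensor. -/
theorem stmt_3 (n s : ℕ) (hn : 3 ≤ n) (hs : 1 ≤ s)
    (V : (Fin n → ℝ) → (Fin s → Fin n) → ℝ) (hV : IsSTF n s V)
    (A : (k : Fin s) → (Fin n → ℝ) → (Fin (k : ℕ) → Fin n) → ℝ)
    (hA : ∀ (k : Fin s) (b : Fin (k : ℕ) → Fin n), ContDiff ℝ (⊤ : ℕ∞) fun x => A k x b)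
    (t : ℕ)
    (B : (k : Fin (t + 1)) → (Fin n → ℝ) → (Fin (k : ℕ) → Fin n) → ℝ)
    (hB : ∀ (k : Fin (t + 1)) (b : Fin (k : ℕ) → Fin n), ContDiff ℝ (⊤ : ℕ∞) fun x => B k x b)
    (hsym : ∀ f : (Fin n → ℝ) → ℝ, ContDiff ℝ (⊤ : ℕ∞) f →
      lap (fun x => (∑ b : Fin s → Fin n, V x b * pds b f x)
          + ∑ k : Fin s, ∑ b : Fin (k : ℕ) → Fin n, A k x b * pds b f x)
        = fun x => ∑ k : Fin (t + 1), ∑ b : Fin (k : ℕ) → Fin n,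
            B k x b * pds b (lap f) x) :
    IsCKT n s V := by
  classical
  refine ⟨hV, fun x₀ => ?_⟩
  obtain ⟨r, rfl⟩ : ∃ r, s = r + 1 := ⟨s - 1, by omega⟩
  obtain ⟨hVs, hVsym, hVtr⟩ := hV
  have hUsym (a : Fin n) : IsSymTensor fun b => pd a (fun y => V y b) x₀ := fun σ b => by
    simp only [hVsym]
  have hUtr (a : Fin n) (i j : Fin (r + 1)) (hij : i ≠ j) (b : Fin (r + 1) → Fin n) :
      ∑ e, pd a (fun y => V y (Function.update (Function.update b i e) j e)) x₀ = 0 := by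
    have h := congrFun (pd_sum Finset.univ
      (fun e => hVs (Function.update (Function.update b i e) j e)) a) x₀
    rw [← h]
    simp [hVtr _ i j hij b, pd]
  let κ : (Fin (r + 2) → Fin n) → ℝ := fun c => pd (c 0) (fun y => V y fun i => c i.succ) x₀
  let w : (Fin r → Fin n) → ℝ := fun b =>
    ∑ e, pd e (fun y => V y (Fin.cons e b : Fin (r + 1) → Fin n)) x₀
  let δ : (Fin (r + 2) → Fin n) → ℝ := fun c =>
    (if c 0 = c 1 then 1 else 0) * w fun i => c i.succ.succ
  let l : ℝ := ((r : ℝ) + 1) / (n + 2 * r)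
  let T : (Fin (r + 2) → Fin n) → ℝ := symTensor (κ - l • δ)
  have hl : l * (2 * n + 4 * r) = 2 * ((r : ℝ) + 1) := by
    have : (n : ℝ) + 2 * r ≠ 0 := by positivity
    simp only [l]
    field_simp
    ring
  have hdiv (b : Fin r → Fin n) : divT n (r + 1) V x₀ b = w b := by
    refine Finset.sum_congr rfl fun e _ => ?_
    congr 3 with y
    congr 1 with j
    cases j using Fin.cases <;> simp
  have hwsym : IsSymTensor w := fun σ b =>
    Finset.sum_congr rfl fun e _ => (hUsym e).cons e σ b
  have hU0 (a : Fin n) : polyLap (tensorPoly fun b => pd a (fun y => V y b) x₀) = 0 :=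
    polyLap_tensorPoly_eq_zero (hUsym a) (hUtr a)
  have hdivU : ∑ a, pderiv a (tensorPoly fun b => pd a (fun y => V y b) x₀) =
      ((r : ℝ) + 1) • tensorPoly w := by
    simp only [pderiv_tensorPoly (hUsym _), ← Finset.smul_sum, ← map_sum]
    congr 2
    funext b
    simp [w]
  have hw0 : polyLap (tensorPoly w) = 0 := by
    have h : polyLap (((r : ℝ) + 1) • tensorPoly w) = 0 := by
      rw [← hdivU, map_sum]
      refine Finset.sum_eq_zero fun a _ => ?_
      rw [polyLap_apply]
      simp only [pderiv_pderiv_comm _ a]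
      rw [← map_sum, ← polyLap_apply, hU0, map_zero]
    rw [map_smul] at h
    exact (smul_eq_zero.mp h).resolve_left (by positivity)
  have hκ : tensorPoly κ = ∑ a, X a * tensorPoly fun b => pd a (fun y => V y b) x₀ := by
    rw [tensorPoly_succ]
    rfl
  have hδ : tensorPoly δ = (∑ a, X a * X a) * tensorPoly w := by
    rw [tensorPoly_succ, Finset.sum_mul]
    refine Finset.sum_congr rfl fun a _ => ?_
    rw [tensorPoly_succ, mul_assoc]
    congr 1
    rw [Finset.sum_eq_single a]
    · simp [δ]
    · intro b _ hb
      have : (fun c : Fin r → Fin n => δ (Fin.cons a (Fin.cons b c : Fin (r + 1) → Fin n))) = 0 := by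
        funext c
        simp [δ, hb.symm]
      rw [this, map_zero, mul_zero]
    · simp
  have hTsym : IsSymTensor T := isSymTensor_symTensor _
  have hT0 : polyLap (tensorPoly T) = 0 := by
    rw [tensorPoly_symTensor, map_sub, map_smul, map_smul, map_sub, map_smul, hκ, hδ,
      polyLap_sum_X_mul _ hU0, hdivU, polyLap_sq_mul_tensorPoly hwsym hw0, smul_smul, hl,
      show (2 : MvPolynomial (Fin n) ℝ) = C 2 from rfl, ← smul_eq_C_mul, smul_smul, sub_self,
      smul_zero]
  have hκT : ∑ c, κ c * T c = 0 := sum_pd_symbol_mul_eq_zero hVs hA hsym x₀ hTsym hT0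
  have htr (c : Fin r → Fin n) :
      ∑ e, T (Fin.cons e (Fin.cons e c : Fin (r + 1) → Fin n)) = 0 := by
    have h := polyLap_pderivs_comm c (tensorPoly T)
    rw [hT0, map_zero, polyLap_apply] at h
    simp only [← pderivs_cons, pderivs_tensorPoly hTsym] at h
    replace h := congrArg (eval 0) h
    simp only [map_sum, eval_C, ← Finset.mul_sum, map_zero] at h
    simpa [Nat.factorial_ne_zero] using h
  have hδT : ∑ c, δ c * T c = 0 := by
    simp only [sum_fin_succ_fun]
    have h (a : Fin n) : ∑ b, ∑ c : Fin r → Fin n,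
        δ (Fin.cons a (Fin.cons b c : Fin (r + 1) → Fin n)) *
          T (Fin.cons a (Fin.cons b c : Fin (r + 1) → Fin n)) =
        ∑ c, w c * T (Fin.cons a (Fin.cons a c : Fin (r + 1) → Fin n)) := by
      rw [Finset.sum_eq_single a]
      · simp [δ]
      · intro b _ hb
        simp [δ, hb.symm]
      · simp
    simp only [h]
    rw [Finset.sum_comm]
    simp [← Finset.mul_sum, htr]
  have hTT : ∑ c, T c ^ 2 = 0 := by
    rw [← sum_mul_symTensor]
    simp only [Pi.sub_apply, Pi.smul_apply, smul_eq_mul, sub_mul, Finset.sum_sub_distrib, mul_assoc,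
      ← Finset.mul_sum]
    change _ * (∑ c, κ c * T c - l * ∑ c, δ c * T c) = 0
    rw [hκT, hδT, mul_zero, sub_zero, mul_zero]
  intro c
  have hTc : T c = 0 := by
    simpa using (Finset.sum_eq_zero_iff_of_nonneg fun c _ => sq_nonneg (T c)).mp hTT c
  have hl' : ((r + 1 : ℕ) : ℝ) / ((n : ℝ) + 2 * (r + 1 : ℕ) - 2) = l := by
    simp only [l]
    push_cast
    congr 1
    ring
  simp only [hl', hdiv]
  change ∑ σ : Equiv.Perm (Fin (r + 2)), (κ (c ∘ σ) - l * δ (c ∘ σ)) = 0 at hTc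
  rw [Finset.sum_sub_distrib, ← Finset.mul_sum, sub_eq_zero] at hTc
  exact hTc
end

section
/- Let n ≥ 3. The set of conformal Killing 2-tensors on ℝⁿ is a real vector subspace of the space of smooth symmetric trace-free 2-tensor fields on ℝⁿ, and its dimension equals (n−1)(n+2)(n+3)(n+4)/12. -/
/-- A conformal Killing 2-tensor on ℝⁿ: a smooth symmetric trace-free 2-tensor field
with `∂_a V^{bc} + ∂_b V^{ca} + ∂_c V^{ab} = (2/(n+2))(δ_{ab} w^c + δ_{bc} w^a + δ_{ca} w^b)`
where `w^c = Σ_e ∂_e V^{ce}`. -/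
def IsCKT2 (n : ℕ) (V : (Fin n → ℝ) → Fin n → Fin n → ℝ) : Prop :=
  (∀ a b, ContDiff ℝ (⊤ : ℕ∞) fun x => V x a b) ∧
  (∀ x a b, V x a b = V x b a) ∧
  (∀ x, ∑ a, V x a a = 0) ∧
  (∀ (a b c : Fin n) (x : Fin n → ℝ),
    pd a (fun y => V y b c) x + pd b (fun y => V y c a) x + pd c (fun y => V y a b) x
      = 2 / ((n : ℝ) + 2) *
        ((if a = b then (1 : ℝ) else 0) * (∑ e, pd e (fun y => V y c e) x)
          + (if b = c then (1 : ℝ) else 0) * (∑ e, pd e (fun y => V y a e) x)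
          + (if c = a then (1 : ℝ) else 0) * (∑ e, pd e (fun y => V y b e) x)))

section Compatibility

theorem eq_zero_of_ofNat_smul (R : Type*) {M : Type*} [CommRing R] [AddCommGroup M]
    [Module R M] [IsAddTorsionFree M] (k : ℕ) [k.AtLeastTwo] {x : M}
    (h : (OfNat.ofNat k : R) • x = 0) : x = 0 := by
  rw [ofNat_smul_eq_nsmul] at h
  exact (smul_eq_zero.mp h).resolve_left (NeZero.ne _)

variable {R M ι : Type*} [CommRing R] [AddCommGroup M] [Module R M]

/-- The curl `∂_i L_j - ∂_j L_i` of a covector with values in a module over the symbol ring. -/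
def curl (d : ι → R) (L : ι → M) (i j : ι) : M := d i • L j - d j • L i

/-- The conformal Killing equation for a 2-tensor `V` with divergence part `L`, over a ring `R` of
commuting symbols `d i`. -/
def ConfKillingEq [DecidableEq ι] (d : ι → R) (V : ι → ι → M) (L : ι → M) : Prop :=
  ∀ a b c, d a • V b c + d b • V c a + d c • V a b =
    (if a = b then (1 : R) else 0) • L c + (if b = c then (1 : R) else 0) • L a +
      (if c = a then (1 : R) else 0) • L b

theorem curl_swap (d : ι → R) (L : ι → M) (i j : ι) : curl d L i j = -curl d L j i := by
  simp [curl]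

theorem curl_self (d : ι → R) (L : ι → M) (i : ι) : curl d L i i = 0 := by
  simp [curl]

theorem curl_smul (d : ι → R) (L : ι → M) (r : R) (i j : ι) :
    curl d (fun i => r • L i) i j = r • curl d L i j := by
  simp only [curl]
  module

theorem curl_cocycle (d : ι → R) (L : ι → M) (i j k : ι) :
    d i • curl d L j k + d j • curl d L k i + d k • curl d L i j = 0 := by
  simp only [curl]
  module

/-- The Saint-Venant compatibility condition of the conformal Killing equation. -/
theorem saint_venant (d : ι → R) (V : ι → ι → M) (L : ι → M) (g : ι → ι → R)
    (E : ∀ a b c, d a • V b c + d b • V c a + d c • V a b = g a b • L c + g b c • L a + g c a • L b)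
    (a b c e p q : ι) :
    (g a c * d b * d e - g a e * d b * d c - g b c * d a * d e + g b e * d a * d c) • curl d L p q +
    (g c p * d e * d q - g c q * d e * d p - g e p * d c * d q + g e q * d c * d p) • curl d L a b +
    (g p a * d q * d b - g p b * d q * d a - g q a * d p * d b + g q b * d p * d a) • curl d L c e
      = 0 := by
  simp only [curl]
  linear_combination (norm := module) (d b * d e * d q) • E a c p - (d a * d e * d q) • E b c p
    - (d b * d c * d q) • E a e p + (d a * d c * d q) • E b e p
    - (d b * d e * d p) • E a c q + (d a * d e * d p) • E b c q
    + (d b * d c * d p) • E a e q - (d a * d c * d p) • E b e q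

namespace ConfKillingEq

variable [DecidableEq ι] {d : ι → R} {V : ι → ι → M} {L : ι → M}

theorem smul (h : ConfKillingEq d V L) (r : R) :
    ConfKillingEq d (fun i j => r • V i j) (fun i => r • L i) := fun a b c => by
  linear_combination (norm := module) r • h a b c

theorem sq_add_sq_smul_curl [IsAddTorsionFree M] (h : ConfKillingEq d V L) {i j : ι} (hij : i ≠ j) :
    (d i ^ 2 + d j ^ 2) • curl d L i j = 0 := by
  have := saint_venant d V L _ h i j i j i j
  simp only [hij, hij.symm, if_true, if_false] at this
  refine eq_zero_of_ofNat_smul R 3 ?_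
  linear_combination (norm := module) this

theorem sq_add_sq_smul_curl_add (h : ConfKillingEq d V L) {i j k : ι} (hij : i ≠ j) (hik : i ≠ k)
    (hjk : j ≠ k) :
    (d j ^ 2 + d k ^ 2) • curl d L i j + (2 * d k * d i) • curl d L k j = 0 := by
  have := saint_venant d V L _ h k j k j i j
  simp only [hij, hij.symm, hik, hik.symm, hjk, hjk.symm, if_true, if_false] at this
  linear_combination (norm := module) this

/-- Transversal second derivatives of the curl vanish. -/
theorem sq_smul_curl [IsAddTorsionFree M] (h : ConfKillingEq d V L) {i j k : ι} (hij : i ≠ j)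
    (hik : i ≠ k)
    (hjk : j ≠ k) : d k ^ 2 • curl d L i j = 0 := by
  refine eq_zero_of_ofNat_smul R 4 ?_
  have h1 := h.sq_add_sq_smul_curl hij
  have h2 := h.sq_add_sq_smul_curl_add hij hik hjk
  have h3 := h.sq_add_sq_smul_curl_add hij.symm hjk hik
  have h4 := curl_cocycle d L i j k
  simp only [curl] at *
  linear_combination (norm := module) h2 - h3 - h1 + (2 * d k) • h4

theorem mul_smul_curl_cyclic (h : ConfKillingEq d V L) {i j k l : ι} (hij : i ≠ j) (hik : i ≠ k)
    (hil : i ≠ l) (hjk : j ≠ k) (hjl : j ≠ l) (hkl : k ≠ l) :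
    (d k * d i) • curl d L l j + (d i * d l) • curl d L k j + (d l * d k) • curl d L i j = 0 := by
  have := saint_venant d V L _ h k j i j l j
  simp only [hij, hij.symm, hik.symm, hjk, hjk.symm, hil, hjl, hjl.symm, hkl.symm, if_true,
    if_false] at this
  linear_combination (norm := module) this

theorem mul_smul_curl [IsAddTorsionFree M] (h : ConfKillingEq d V L) {i j k l : ι} (hij : i ≠ j)
    (hik : i ≠ k)
    (hil : i ≠ l) (hjk : j ≠ k) (hjl : j ≠ l) (hkl : k ≠ l) :
    (d k * d l) • curl d L i j = 0 := by
  refine eq_zero_of_ofNat_smul R 4 ?_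
  have h1 := h.mul_smul_curl_cyclic hij hik hil hjk hjl hkl
  have h2 := h.mul_smul_curl_cyclic hij.symm hjk hjl hik hil hkl
  have h3 := curl_cocycle d L i j k
  have h4 := curl_cocycle d L i j l
  simp only [curl] at *
  linear_combination (norm := module) h1 - h2 + d l • h3 + d k • h4

theorem sq_smul_curl_eq [IsAddTorsionFree M] (h : ConfKillingEq d V L) {i j k : ι} (hij : i ≠ j)
    (hik : i ≠ k)
    (hjk : j ≠ k) : d j ^ 2 • curl d L i j = (2 * d k * d i) • curl d L j k := by
  have h1 := h.sq_add_sq_smul_curl_add hij hik hjk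
  have h2 := h.sq_smul_curl hij hik hjk
  rw [curl_swap d L k j] at h1
  linear_combination (norm := module) h1 - h2

theorem mul_smul_curl_cycle (h : ConfKillingEq d V L) {i j k : ι} (hij : i ≠ j) (hik : i ≠ k)
    (hjk : j ≠ k) : (d i * d j) • curl d L i j + (d j * d k) • curl d L j k +
      (d k * d i) • curl d L k i = 0 := by
  have := saint_venant d V L _ h i j i k j k
  simp only [hij, hij.symm, hik, hik.symm, hjk, hjk.symm, if_true, if_false] at this
  rw [curl_swap d L k i]
  linear_combination (norm := module) this

theorem sq_smul_curl_symm [IsAddTorsionFree M] (h : ConfKillingEq d V L) (i j : ι) :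
    d j ^ 2 • curl d L i j = d i ^ 2 • curl d L j i := by
  rcases eq_or_ne i j with rfl | hij
  · rfl
  have := h.sq_add_sq_smul_curl hij
  rw [curl_swap d L j i]
  linear_combination (norm := module) this

/-- The second derivatives of the curl are determined by those in the plane of its indices. -/
theorem second_smul_curl_eq_zero [IsAddTorsionFree M] (h : ConfKillingEq d V L)
    (h1 : ∀ i j, i ≠ j → d j ^ 2 • curl d L i j = 0)
    (h2 : ∀ i j, i ≠ j → (d i * d j) • curl d L i j = 0) (k l i j : ι) :
    (d k * d l) • curl d L i j = 0 := by
  have hsq : ∀ i j, i ≠ j → d i ^ 2 • curl d L i j = 0 := fun i j hij => by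
    rw [curl_swap, smul_neg, h1 j i hij.symm, neg_zero]
  have hr : ∀ i j k, i ≠ j → i ≠ k → j ≠ k → (d j * d k) • curl d L i j = 0 :=
    fun i j k hij hik hjk => by
      refine eq_zero_of_ofNat_smul R 2 ?_
      have := h.sq_smul_curl_eq hik.symm hjk.symm hij
      rw [h1 k i hik.symm] at this
      linear_combination (norm := module) -this
  have hl : ∀ i j k, i ≠ j → i ≠ k → j ≠ k → (d i * d k) • curl d L i j = 0 :=
    fun i j k hij hik hjk => by
      rw [curl_swap, smul_neg, hr j i k hij.symm hjk hik, neg_zero]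
  rcases eq_or_ne i j with rfl | hij
  · rw [curl_self, smul_zero]
  rcases eq_or_ne k l with rfl | hkl
  · rw [← pow_two]
    rcases eq_or_ne i k with rfl | hik
    · exact hsq _ _ hij
    rcases eq_or_ne j k with rfl | hjk
    · exact h1 _ _ hij
    exact h.sq_smul_curl hij hik hjk
  rcases eq_or_ne i k with rfl | hik
  · rcases eq_or_ne j l with rfl | hjl
    · exact h2 _ _ hij
    exact hl _ _ _ hij hkl hjl
  rcases eq_or_ne j k with rfl | hjk
  · rcases eq_or_ne i l with rfl | hil
    · rw [mul_comm]; exact h2 _ _ hij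
    exact hr _ _ _ hij hil hkl
  rw [mul_comm]
  rcases eq_or_ne i l with rfl | hil
  · exact hl _ _ _ hij hik hjk
  rcases eq_or_ne j l with rfl | hjl
  · exact hr _ _ _ hij hik hjk
  exact h.mul_smul_curl hij hil hik hjl hjk hkl.symm

/-- All third derivatives of the curl vanish in dimension at least three. -/
theorem third_smul_curl_eq_zero [IsAddTorsionFree M] (h : ConfKillingEq d V L)
    (h3 : ∀ i j : ι, ∃ k, i ≠ k ∧ j ≠ k)
    (m k l i j : ι) : (d m * d k * d l) • curl d L i j = 0 := by
  have hcyc : ∀ i j k, i ≠ j → i ≠ k → j ≠ k →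
      d i • d k ^ 2 • curl d L j k = (2 : R) • d j • d i ^ 2 • curl d L k i :=
    fun i j k hij hik hjk => by
      linear_combination (norm := module) d i • h.sq_smul_curl_eq hjk hij.symm hik.symm
  have hU1 : ∀ i j k, i ≠ j → i ≠ k → j ≠ k → d i • d k ^ 2 • curl d L j k = 0 :=
    fun i j k hij hik hjk => by
      refine eq_zero_of_ofNat_smul R 3 ?_
      have e1 := hcyc i j k hij hik hjk
      have e2 := hcyc j i k hij.symm hjk hik
      rw [h.sq_smul_curl_symm k i] at e1
      rw [h.sq_smul_curl_symm k j] at e2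
      linear_combination (norm := module) -e1 - (2 : R) • e2
  have hU2 : ∀ i k, i ≠ k → d k • d k ^ 2 • curl d L i k = 0 := fun i k hik => by
    obtain ⟨j, hij, hkj⟩ := h3 i k
    have e1 := h.sq_smul_curl_eq hik.symm hkj hij
    have e2 := h.sq_smul_curl hij hik hkj.symm
    rw [h.sq_smul_curl_symm]
    linear_combination (norm := module) d k • e1 + (2 * d j) • e2
  have hU : ∀ m i j, i ≠ j → d m • d j ^ 2 • curl d L i j = 0 := fun m i j hij => by
    rcases eq_or_ne m i with rfl | hmi
    · rw [h.sq_smul_curl_symm]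
      exact hU2 _ _ hij.symm
    rcases eq_or_ne m j with rfl | hmj
    · exact hU2 _ _ hij
    exact hU1 _ _ _ hmi hmj hij
  have hW1 : ∀ i j, i ≠ j → d i • (d i * d j) • curl d L i j = 0 := fun i j hij => by
    have := hU j j i hij.symm
    rw [curl_swap] at this
    linear_combination (norm := module) -this
  have hW : ∀ m i j, i ≠ j → d m • (d i * d j) • curl d L i j = 0 := fun m i j hij => by
    rcases eq_or_ne m i with rfl | hmi
    · exact hW1 _ _ hij
    rcases eq_or_ne m j with rfl | hmj
    · have := hW1 _ _ hij.symm
      rw [curl_swap, mul_comm]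
      linear_combination (norm := module) -this
    refine eq_zero_of_ofNat_smul R 2 ?_
    have e1 := h.sq_smul_curl_eq hmi hmj hij
    have e2 := hU i m i hmi
    linear_combination (norm := module) e2 - d i • e1
  have := (h.smul (d m)).second_smul_curl_eq_zero
    (fun i j hij => by rw [curl_smul, smul_comm]; exact hU m i j hij)
    (fun i j hij => by rw [curl_smul, smul_comm]; exact hW m i j hij) k l i j
  rw [curl_smul] at this
  linear_combination (norm := module) this

end ConfKillingEq
end Compatibility

section PhasePolynomials

open MvPolynomial

theorem MvPolynomial.pderiv_comm {σ R : Type*} [CommRing R] (i j : σ) (f : MvPolynomial σ R) :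
    pderiv i (pderiv j f) = pderiv j (pderiv i f) := by
  classical
  have : ⁅pderiv i, pderiv j⁆ = (0 : Derivation R (MvPolynomial σ R) (MvPolynomial σ R)) :=
    derivation_ext fun k => by
      rw [Derivation.commutator_apply, pderiv_X, pderiv_X]
      simp only [Pi.single_apply]
      split_ifs <;> simp
  rw [← sub_eq_zero, ← Derivation.commutator_apply, this, Derivation.zero_apply]

theorem Derivation.finset_sum_apply {R A M ι : Type*} [CommRing R] [CommRing A] [AddCommGroup M]
    [Algebra R A] [Module A M] [Module R M] (s : Finset ι) (f : ι → Derivation R A M) (a : A) :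
    (∑ i ∈ s, f i) a = ∑ i ∈ s, f i a := by
  classical
  induction s using Finset.induction_on with
  | empty => simp
  | insert i s hi ih => simp [Finset.sum_insert hi, ih]

/-- Polynomials on phase space, in the positions `X (Sum.inl i)` and momenta `X (Sum.inr i)`. -/
abbrev PhasePoly (n : ℕ) := MvPolynomial (Fin n ⊕ Fin n) ℝ

namespace PhasePoly

variable {n : ℕ}

/-- The position variables. -/
noncomputable abbrev x (i : Fin n) : PhasePoly n := X (Sum.inl i)

/-- The momentum variables. -/
noncomputable abbrev p (i : Fin n) : PhasePoly n := X (Sum.inr i)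

/-- The position derivatives. -/
noncomputable abbrev dx (i : Fin n) : Derivation ℝ (PhasePoly n) (PhasePoly n) :=
  pderiv (Sum.inl i)

/-- The momentum derivatives. -/
noncomputable abbrev dp (i : Fin n) : Derivation ℝ (PhasePoly n) (PhasePoly n) :=
  pderiv (Sum.inr i)

/-- The bidegree of the variables. -/
def wt : Fin n ⊕ Fin n → ℕ × ℕ := Sum.elim (fun _ => (1, 0)) (fun _ => (0, 1))

/-- Bihomogeneous polynomials of degree `k` in position and `l` in momentum. -/
noncomputable def bideg (n k l : ℕ) : Submodule ℝ (PhasePoly n) :=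
  weightedHomogeneousSubmodule ℝ wt (k, l)

/-- The symmetrised gradient `p · ∂_x`. -/
noncomputable def grad : Derivation ℝ (PhasePoly n) (PhasePoly n) := ∑ i, p i • dx i

/-- The transposed operator `x · ∂_p`. -/
noncomputable def cograd : Derivation ℝ (PhasePoly n) (PhasePoly n) := ∑ i, x i • dp i

/-- The metric `|p|²`. -/
noncomputable def psq (n : ℕ) : PhasePoly n := ∑ i, p i ^ 2

/-- The trace `Δ_p`. -/
noncomputable def lapP : PhasePoly n →ₗ[ℝ] PhasePoly n :=
  ∑ i, (dp i).toLinearMap ∘ₗ (dp i).toLinearMap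

/-- The divergence `∂_x · ∂_p`. -/
noncomputable def divP : PhasePoly n →ₗ[ℝ] PhasePoly n :=
  ∑ i, (dx i).toLinearMap ∘ₗ (dp i).toLinearMap

theorem grad_apply (F : PhasePoly n) : grad F = ∑ i, p i * dx i F := by
  simp [grad, Derivation.finset_sum_apply]

theorem cograd_apply (F : PhasePoly n) : cograd F = ∑ i, x i * dp i F := by
  simp [cograd, Derivation.finset_sum_apply]

theorem lapP_apply (F : PhasePoly n) : lapP F = ∑ i, dp i (dp i F) := by
  simp [lapP]

theorem divP_apply (F : PhasePoly n) : divP F = ∑ i, dx i (dp i F) := by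
  simp [divP]

@[simp] theorem dx_x (i j : Fin n) : dx i (x j) = if i = j then 1 else 0 := by
  simp [dx, x, pderiv_X, Pi.single_apply, eq_comm]

@[simp] theorem dx_p (i j : Fin n) : dx i (p j) = 0 := by
  simp [dx, p, pderiv_X]

@[simp] theorem dp_x (i j : Fin n) : dp i (x j) = 0 := by
  simp [dp, x, pderiv_X]

@[simp] theorem dp_p (i j : Fin n) : dp i (p j) = if i = j then 1 else 0 := by
  simp [dp, p, pderiv_X, Pi.single_apply, eq_comm]

@[simp] theorem dx_psq (i : Fin n) : dx i (psq n) = 0 := by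
  simp [psq, pow_two]

@[simp] theorem dp_psq (i : Fin n) : dp i (psq n) = (2 : ℝ) • p i := by
  simp only [psq, map_sum, pow_two, Derivation.leibniz, dp_p, smul_eq_mul, mul_ite, mul_one,
    mul_zero, Finset.sum_add_distrib, Finset.sum_ite_eq, Finset.mem_univ, if_true, two_smul]

theorem dx_comm (i j : Fin n) (F : PhasePoly n) : dx i (dx j F) = dx j (dx i F) :=
  pderiv_comm _ _ F

theorem dp_comm (i j : Fin n) (F : PhasePoly n) : dp i (dp j F) = dp j (dp i F) :=
  pderiv_comm _ _ F

theorem dp_dx (i j : Fin n) (F : PhasePoly n) : dp i (dx j F) = dx j (dp i F) :=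
  pderiv_comm _ _ F

theorem isWeightedHomogeneous_wt {k l : ℕ} {F : PhasePoly n} (h : F ∈ bideg n k l) :
    IsWeightedHomogeneous wt F (k, l) := h

theorem mul_mem {k l k' l' : ℕ} {F G : PhasePoly n} (hF : F ∈ bideg n k l)
    (hG : G ∈ bideg n k' l') : F * G ∈ bideg n (k + k') (l + l') :=
  IsWeightedHomogeneous.mul hF hG

theorem x_mem (i : Fin n) : x i ∈ bideg n 1 0 := isWeightedHomogeneous_X ℝ wt (Sum.inl i)

theorem p_mem (i : Fin n) : p i ∈ bideg n 0 1 := isWeightedHomogeneous_X ℝ wt (Sum.inr i)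

theorem dx_mem {k l : ℕ} {F : PhasePoly n} (h : F ∈ bideg n (k + 1) l) (i : Fin n) :
    dx i F ∈ bideg n k l :=
  IsWeightedHomogeneous.pderiv h (by simp [wt])

theorem dp_mem {k l : ℕ} {F : PhasePoly n} (h : F ∈ bideg n k (l + 1)) (i : Fin n) :
    dp i F ∈ bideg n k l :=
  IsWeightedHomogeneous.pderiv h (by simp [wt])

theorem dx_eq_zero {l : ℕ} {F : PhasePoly n} (h : F ∈ bideg n 0 l) (i : Fin n) : dx i F = 0 := by
  ext m
  rw [coeff_pderiv, isWeightedHomogeneous_wt h |>.coeff_eq_zero]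
  · simp
  · simp [Finsupp.weight_single, wt, Prod.ext_iff]

theorem dp_eq_zero {k : ℕ} {F : PhasePoly n} (h : F ∈ bideg n k 0) (i : Fin n) : dp i F = 0 := by
  ext m
  rw [coeff_pderiv, isWeightedHomogeneous_wt h |>.coeff_eq_zero]
  · simp
  · simp [Finsupp.weight_single, wt, Prod.ext_iff]

theorem grad_mem {k l : ℕ} {F : PhasePoly n} (h : F ∈ bideg n (k + 1) l) :
    grad F ∈ bideg n k (l + 1) := by
  rw [grad_apply]
  refine Submodule.sum_mem _ fun i _ => ?_
  simpa [add_comm] using mul_mem (p_mem i) (dx_mem h i)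

theorem grad_eq_zero {l : ℕ} {F : PhasePoly n} (h : F ∈ bideg n 0 l) : grad F = 0 := by
  simp [grad_apply, dx_eq_zero h]

theorem cograd_mem {k l : ℕ} {F : PhasePoly n} (h : F ∈ bideg n k (l + 1)) :
    cograd F ∈ bideg n (k + 1) l := by
  rw [cograd_apply]
  refine Submodule.sum_mem _ fun i _ => ?_
  simpa [add_comm] using mul_mem (x_mem i) (dp_mem h i)

theorem cograd_eq_zero {k : ℕ} {F : PhasePoly n} (h : F ∈ bideg n k 0) : cograd F = 0 := by
  simp [cograd_apply, dp_eq_zero h]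

theorem psq_mem : psq n ∈ bideg n 0 2 := by
  refine Submodule.sum_mem _ fun i _ => ?_
  rw [pow_two]
  exact mul_mem (p_mem i) (p_mem i)

theorem psq_mul_mem {k l : ℕ} {F : PhasePoly n} (h : F ∈ bideg n k l) :
    psq n * F ∈ bideg n k (l + 2) := by
  simpa [add_comm] using mul_mem psq_mem h

theorem lapP_mem {k l : ℕ} {F : PhasePoly n} (h : F ∈ bideg n k (l + 2)) :
    lapP F ∈ bideg n k l := by
  rw [lapP_apply]
  exact Submodule.sum_mem _ fun i _ => dp_mem (dp_mem h i) i

theorem divP_mem {k l : ℕ} {F : PhasePoly n} (h : F ∈ bideg n (k + 1) (l + 1)) :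
    divP F ∈ bideg n k l := by
  rw [divP_apply]
  exact Submodule.sum_mem _ fun i _ => dx_mem (dp_mem h i) i

theorem euler_x {k l : ℕ} {F : PhasePoly n} (h : F ∈ bideg n k l) :
    ∑ i, x i * dx i F = (k : ℝ) • F := by
  have : IsWeightedHomogeneous (Sum.elim (fun _ => 1) (fun _ => 0) : Fin n ⊕ Fin n → ℕ) F k :=
    fun m hm => by
      have := congr_arg Prod.fst (h hm)
      simpa [Finsupp.weight_apply, Finsupp.sum_fintype, Prod.fst_sum, wt] using this
  simpa [Nat.cast_smul_eq_nsmul] using this.sum_weight_X_mul_pderiv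

theorem euler_p {k l : ℕ} {F : PhasePoly n} (h : F ∈ bideg n k l) :
    ∑ i, p i * dp i F = (l : ℝ) • F := by
  have : IsWeightedHomogeneous (Sum.elim (fun _ => 0) (fun _ => 1) : Fin n ⊕ Fin n → ℕ) F l :=
    fun m hm => by
      have := congr_arg Prod.snd (h hm)
      simpa [Finsupp.weight_apply, Finsupp.sum_fintype, Prod.snd_sum, wt] using this
  simpa [Nat.cast_smul_eq_nsmul] using this.sum_weight_X_mul_pderiv

theorem eq_zero_of_dx_eq_zero {k l : ℕ} {F : PhasePoly n} (h : F ∈ bideg n (k + 1) l)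
    (h0 : ∀ i, dx i F = 0) : F = 0 := by
  have := euler_x h
  simp only [h0, mul_zero, Finset.sum_const_zero] at this
  exact (smul_eq_zero.mp this.symm).resolve_left (by positivity)

theorem eq_zero_of_dp_eq_zero {k l : ℕ} {F : PhasePoly n} (h : F ∈ bideg n k (l + 1))
    (h0 : ∀ i, dp i F = 0) : F = 0 := by
  have := euler_p h
  simp only [h0, mul_zero, Finset.sum_const_zero] at this
  exact (smul_eq_zero.mp this.symm).resolve_left (by positivity)

theorem grad_cograd {k l : ℕ} {F : PhasePoly n} (h : F ∈ bideg n k l) :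
    grad (cograd F) = cograd (grad F) + ((l : ℝ) - k) • F := by
  have key : ⁅(grad : Derivation ℝ (PhasePoly n) (PhasePoly n)), cograd⁆ =
      (∑ i, p i • dp i) - ∑ i : Fin n, x i • dx i := by
    refine derivation_ext fun i => ?_
    rcases i with i | i
    · simp [Derivation.commutator_apply, grad_apply, cograd_apply, Derivation.finset_sum_apply,
        Pi.single_apply]
    · simp [Derivation.commutator_apply, grad_apply, cograd_apply, Derivation.finset_sum_apply,
        Pi.single_apply]
  have h2 := congr_arg (fun d => d F) key
  simp only [Derivation.commutator_apply, Derivation.sub_apply, Derivation.finset_sum_apply,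
    Derivation.smul_apply, smul_eq_mul, euler_x h, euler_p h] at h2
  rw [sub_smul, ← h2]
  abel

end PhasePoly
end PhasePolynomials

section PolynomialSolutions

open MvPolynomial

namespace PhasePoly

variable {n : ℕ}

theorem dp_grad (a : Fin n) (F : PhasePoly n) : dp a (grad F) = dx a F + grad (dp a F) := by
  simp only [grad_apply, map_sum, Derivation.leibniz, dp_p, smul_eq_mul, mul_ite, mul_one,
    mul_zero, Finset.sum_add_distrib, Finset.sum_ite_eq, Finset.mem_univ, if_true]
  rw [add_comm]
  exact congr_arg _ (Finset.sum_congr rfl fun i _ => by rw [dp_dx])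

theorem grad_psq : grad (psq n) = 0 := by
  simp [grad_apply]

theorem grad_psq_mul (F : PhasePoly n) : grad (psq n * F) = psq n * grad F := by
  rw [Derivation.leibniz, grad_psq, smul_zero, add_zero, smul_eq_mul]

theorem lapP_psq_mul {k : ℕ} {f : PhasePoly n} (h : f ∈ bideg n k 0) :
    lapP (psq n * f) = (2 * n : ℝ) • f := by
  simp only [lapP_apply, Derivation.leibniz, dp_psq, dp_eq_zero h, smul_eq_mul, mul_zero, zero_add,
    Derivation.map_smul, dp_p, if_true, mul_smul_comm, mul_one, Finset.sum_const,
    Finset.card_univ, Fintype.card_fin]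
  module

theorem sum_mul_dp_dp {k : ℕ} {F : PhasePoly n} (h : F ∈ bideg n k 2) :
    ∑ b, ∑ c, dp b (dp c F) * (p b * p c) = (2 : ℝ) • F := by
  have h1 (c : Fin n) : ∑ b, dp b (dp c F) * (p b * p c) = p c * dp c F := by
    have := euler_p (dp_mem h c)
    rw [Nat.cast_one, one_smul] at this
    conv_rhs => rw [← this, Finset.mul_sum]
    exact Finset.sum_congr rfl fun b _ => by ring
  rw [Finset.sum_comm]
  simp only [h1, euler_p h, Nat.cast_ofNat]

theorem eq_C_of_mem_bideg {F : PhasePoly n} (h : F ∈ bideg n 0 0) : ∃ r : ℝ, F = C r := by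
  refine ⟨coeff 0 F, ?_⟩
  ext m
  rw [coeff_C]
  split_ifs with hm
  · rw [hm]
  · refine isWeightedHomogeneous_wt h |>.coeff_eq_zero m fun h0 => hm ?_
    have h1 := congr_arg Prod.fst h0
    have h2 := congr_arg Prod.snd h0
    simp [Finsupp.weight_apply, Finsupp.sum_fintype, Prod.fst_sum, Prod.snd_sum, wt] at h1 h2
    ext i
    rcases i with i | i <;> simp [h1, h2]

/-- The commutative ring of constant-coefficient differential operators in the positions. -/
noncomputable abbrev symbols (n : ℕ) : Subalgebra ℝ (Module.End ℝ (PhasePoly n)) :=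
  Algebra.adjoin ℝ (Set.range fun i : Fin n => (dx i).toLinearMap)

instance : IsMulCommutative (symbols n) :=
  Algebra.isMulCommutative_adjoin ℝ (by
    rintro _ ⟨i, rfl⟩ _ ⟨j, rfl⟩
    exact LinearMap.ext (dx_comm i j))

open scoped IsMulCommutative in
noncomputable instance : CommRing (symbols n) := inferInstance

/-- The position derivatives as elements of the ring of symbols. -/
noncomputable def dsym (i : Fin n) : symbols n :=
  ⟨(dx i).toLinearMap, Algebra.subset_adjoin ⟨i, rfl⟩⟩

theorem dsym_smul (i : Fin n) (F : PhasePoly n) : dsym i • F = dx i F := rfl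

/-- The components of the conformal Killing equation `p · ∂_x F = |p|² G`. -/
theorem dx_dp_dp_add {k l : ℕ} {F G : PhasePoly n} (hF : F ∈ bideg n k 2) (hG : G ∈ bideg n l 1)
    (h : grad F = psq n * G) (a b c : Fin n) :
    dx a (dp b (dp c F)) + dx b (dp c (dp a F)) + dx c (dp a (dp b F)) =
      (if a = b then (2 : ℝ) • dp c G else 0) + (if b = c then (2 : ℝ) • dp a G else 0) +
        (if c = a then (2 : ℝ) • dp b G else 0) := by
  have e := congr_arg (fun H => dp a (dp b (dp c H))) h
  simp only [dp_grad, map_add, Derivation.leibniz, dp_psq, Derivation.map_smul, dp_p, smul_eq_mul,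
    mul_zero, dp_eq_zero (dp_mem (dp_mem hF _) _), dp_eq_zero (dp_mem hG _), map_zero, add_zero,
    zero_add,
    dp_dx] at e
  rw [dp_comm c a]
  refine Eq.trans (by abel) (e.trans ?_)
  simp only [eq_comm (a := c)]
  split_ifs <;> simp [mul_comm, add_assoc]
theorem confKillingEq {k l : ℕ} {F G : PhasePoly n} (hF : F ∈ bideg n k 2) (hG : G ∈ bideg n l 1)
    (h : grad F = psq n * G) :
    ConfKillingEq dsym (fun b c => dp b (dp c F)) fun c => (2 : ℝ) • dp c G := fun a b c => by
  simpa only [dsym_smul, ite_smul, one_smul, zero_smul] using dx_dp_dp_add hF hG h a b c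

/-- The only possible right-hand side of the conformal Killing equation. -/
noncomputable def cdiv : PhasePoly n →ₗ[ℝ] PhasePoly n := (1 / ((n : ℝ) + 2)) • divP

theorem cdiv_mem {k l : ℕ} {F : PhasePoly n} (h : F ∈ bideg n (k + 1) (l + 1)) :
    cdiv F ∈ bideg n k l :=
  Submodule.smul_mem _ _ (divP_mem h)

theorem eq_cdiv {k : ℕ} {F G : PhasePoly n} (hF : F ∈ bideg n (k + 1) 2) (hG : G ∈ bideg n k 1)
    (h0 : lapP F = 0) (h : grad F = psq n * G) : G = cdiv F := by
  rw [← sub_eq_zero]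
  refine eq_zero_of_dp_eq_zero (Submodule.sub_mem _ hG (cdiv_mem hF)) fun c => ?_
  have e := Finset.sum_congr rfl fun a (_ : a ∈ Finset.univ) => dx_dp_dp_add hF hG h a a c
  have e2 := congr_arg (fun H => dx c H) h0
  simp only [lapP_apply, map_sum, map_zero] at e2
  have e3 : dp c (divP F) = ∑ i, dx i (dp i (dp c F)) := by
    simp [divP_apply, dp_dx, dp_comm c]
  simp only [Finset.sum_add_distrib, e2, if_true, Finset.sum_ite_eq', Finset.sum_ite_eq,
    Finset.mem_univ, dp_comm c, ← e3] at e
  rw [Finset.sum_const, Finset.card_univ, Fintype.card_fin, ← Nat.cast_smul_eq_nsmul ℝ] at e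
  have hn : (n : ℝ) + 2 ≠ 0 := by positivity
  have e4 : (2 : ℝ) • dp c (divP F) = (2 * ((n : ℝ) + 2)) • dp c G := by
    linear_combination (norm := module) e
  have e5 := congr_arg (fun H => (1 / (2 * ((n : ℝ) + 2))) • H) e4
  simp only [smul_smul] at e5
  rw [map_sub, cdiv, LinearMap.smul_apply, Derivation.map_smul, sub_eq_zero]
  convert e5.symm using 1
  · rw [div_mul_cancel₀ _ (by positivity), one_smul]
  · congr 1
    field_simp

/-- Lowering by `p · ∂_x` is injective on polynomials of momentum degree `2` less than the position
degree. -/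
theorem eq_zero_of_grad_eq_zero {k : ℕ} {F : PhasePoly n} (hF : F ∈ bideg n (k + 3) 2)
    (h : grad F = 0) : F = 0 := by
  have h1 := cograd_mem hF
  have h2 := cograd_mem h1
  have e1 := grad_cograd hF
  have e2 := grad_cograd h1
  have e3 := grad_cograd h2
  rw [h, map_zero, zero_add] at e1
  rw [e1, Derivation.map_smul] at e2
  rw [e2, map_add, Derivation.map_smul, Derivation.map_smul, cograd_eq_zero h2, map_zero] at e3
  push_cast at e1 e2 e3
  have z2 : cograd (cograd F) = 0 := by
    refine (smul_eq_zero.mp (?_ : ((3 : ℝ) * k + 9) • cograd (cograd F) = 0)).resolve_left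
      (by positivity)
    linear_combination (norm := module) e3
  rw [z2, map_zero] at e2
  have z1 : cograd F = 0 := by
    refine (smul_eq_zero.mp (?_ : ((2 : ℝ) * k + 4) • cograd F = 0)).resolve_left (by positivity)
    linear_combination (norm := module) e2
  rw [z1, map_zero] at e1
  refine (smul_eq_zero.mp (?_ : ((k : ℝ) + 1) • F = 0)).resolve_left (by positivity)
  linear_combination (norm := module) e1

theorem grad_cograd_of_curl_eq_zero {k : ℕ} {G : PhasePoly n} (hG : G ∈ bideg n k 1)
    (h : ∀ i j, dx i (dp j G) = dx j (dp i G)) : grad (cograd G) = ((k : ℝ) + 1) • G := by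
  have e1 : cograd (grad G) = (2 * (k : ℝ)) • G := by
    have e2 (i : Fin n) : grad (dp i G) = dx i G := by
      have := congr_arg (fun H => dx i H) (euler_p hG)
      simp only [map_sum, Derivation.leibniz, dx_p, smul_eq_mul, mul_zero, add_zero, Nat.cast_one,
        one_smul] at this
      rw [grad_apply, ← this]
      exact Finset.sum_congr rfl fun j _ => by rw [h]
    simp only [cograd_apply, dp_grad, mul_add, Finset.sum_add_distrib, e2, euler_x hG]
    module
  rw [grad_cograd hG, e1]
  push_cast
  module

/-- The homogeneous polynomial conformal Killing 2-tensors. -/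
noncomputable def ckt (n k : ℕ) : Submodule ℝ (PhasePoly n) where
  carrier := {F | F ∈ bideg n k 2 ∧ lapP F = 0 ∧ grad F = psq n * cdiv F}
  zero_mem' := ⟨Submodule.zero_mem _, map_zero _, by simp⟩
  add_mem' := fun ⟨h1, h2, h3⟩ ⟨h1', h2', h3'⟩ =>
    ⟨Submodule.add_mem _ h1 h1', by rw [map_add, h2, h2', add_zero],
      by rw [map_add, map_add, h3, h3', mul_add]⟩
  smul_mem' := fun r _ ⟨h1, h2, h3⟩ =>
    ⟨Submodule.smul_mem _ r h1, by rw [map_smul, h2, smul_zero],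
      by rw [Derivation.map_smul, map_smul, h3, mul_smul_comm]⟩

theorem mem_ckt_of_grad_eq {k : ℕ} {F G : PhasePoly n} (hF : F ∈ bideg n (k + 1) 2)
    (hG : G ∈ bideg n k 1) (h0 : lapP F = 0) (h : grad F = psq n * G) : F ∈ ckt n (k + 1) :=
  ⟨hF, h0, by rwa [← eq_cdiv hF hG h0 h]⟩

theorem eq_zero_of_curl_eq_zero [NeZero n] {k : ℕ} {F : PhasePoly n} (hF : F ∈ ckt n (k + 3))
    (h : ∀ i j, dx i (dp j (cdiv F)) = dx j (dp i (cdiv F))) : F = 0 := by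
  obtain ⟨h1, h2, h3⟩ := hF
  have hG : cdiv F ∈ bideg n (k + 2) 1 := cdiv_mem h1
  have hf : cograd (cdiv F) ∈ bideg n (k + 3) 0 := cograd_mem hG
  set f := (1 / ((k : ℝ) + 3)) • cograd (cdiv F) with hfdef
  have hf' : f ∈ bideg n (k + 3) 0 := Submodule.smul_mem _ _ hf
  have e : F - psq n * f = 0 := by
    refine eq_zero_of_grad_eq_zero (Submodule.sub_mem _ h1 (psq_mul_mem hf')) ?_
    rw [map_sub, h3, grad_psq_mul, hfdef, Derivation.map_smul, grad_cograd_of_curl_eq_zero hG h,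
      mul_smul_comm, mul_smul_comm, smul_smul]
    push_cast
    rw [show 1 / ((k : ℝ) + 3) * (k + 2 + 1) = 1 by field_simp; ring, one_smul, sub_self]
  rw [sub_eq_zero] at e
  rw [e, lapP_psq_mul hf'] at h2
  rw [e, (smul_eq_zero.mp h2).resolve_left (by simp [NeZero.ne n]), mul_zero]

end PhasePoly
end PolynomialSolutions

section DegreeFourAndFive

open MvPolynomial

namespace PhasePoly

variable {n : ℕ}

/-- The curl `∂_{x_i} ∂_{p_j} G - ∂_{x_j} ∂_{p_i} G`. -/
noncomputable def vort (i j : Fin n) : PhasePoly n →ₗ[ℝ] PhasePoly n :=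
  (dx i).toLinearMap ∘ₗ (dp j).toLinearMap - (dx j).toLinearMap ∘ₗ (dp i).toLinearMap

theorem vort_apply (i j : Fin n) (G : PhasePoly n) :
    vort i j G = dx i (dp j G) - dx j (dp i G) := rfl

theorem vort_mem {k l : ℕ} {G : PhasePoly n} (h : G ∈ bideg n (k + 1) (l + 1)) (i j : Fin n) :
    vort i j G ∈ bideg n k l :=
  Submodule.sub_mem _ (dx_mem (dp_mem h _) _) (dx_mem (dp_mem h _) _)

theorem curl_dsym (G : PhasePoly n) (i j : Fin n) :
    curl dsym (fun c => (2 : ℝ) • dp c G) i j = (2 : ℝ) • vort i j G := by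
  simp only [curl, dsym_smul, Derivation.map_smul, vort_apply, smul_sub]

theorem confKillingEq_of_mem_ckt {k : ℕ} {F : PhasePoly n} (h : F ∈ ckt n (k + 1)) :
    ConfKillingEq dsym (fun b c => dp b (dp c F)) fun c => (2 : ℝ) • dp c (cdiv F) :=
  confKillingEq h.1 (cdiv_mem h.1) h.2.2

theorem eq_zero_of_vort_eq_zero [NeZero n] {k : ℕ} {F : PhasePoly n} (hF : F ∈ ckt n (k + 3))
    (h : ∀ i j, vort i j (cdiv F) = 0) : F = 0 :=
  eq_zero_of_curl_eq_zero hF fun i j => sub_eq_zero.mp (h i j)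

theorem ckt_five (hn : 3 ≤ n) : ckt n 5 = ⊥ := by
  have : NeZero n := ⟨by omega⟩
  refine (Submodule.eq_bot_iff _).mpr fun F hF => eq_zero_of_vort_eq_zero (k := 2) hF fun i j => ?_
  have h3 (i j : Fin n) : ∃ k, i ≠ k ∧ j ≠ k := by
    obtain ⟨k, hk⟩ := Finset.exists_mem_notMem_of_card_lt_card (s := {i, j}) (t := Finset.univ)
      (lt_of_le_of_lt Finset.card_le_two (by simpa [Nat.succ_le_iff] using hn))
    exact ⟨k, by grind⟩
  have hv : vort i j (cdiv F) ∈ bideg n 3 0 := vort_mem (cdiv_mem hF.1) i j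
  refine eq_zero_of_dx_eq_zero hv fun l => eq_zero_of_dx_eq_zero (dx_mem hv l) fun k =>
    eq_zero_of_dx_eq_zero (dx_mem (dx_mem hv l) k) fun m => ?_
  have := (confKillingEq_of_mem_ckt hF).third_smul_curl_eq_zero h3 m k l i j
  rw [curl_dsym, mul_smul, mul_smul] at this
  simp only [dsym_smul, Derivation.map_smul] at this
  exact (smul_eq_zero.mp this).resolve_left two_ne_zero

theorem dp_dp_sum_mul {M : Fin n → Fin n → PhasePoly n} (h : ∀ a i j, dp a (M i j) = 0)
    (a b : Fin n) : dp a (dp b (∑ i, ∑ j, p i * p j * M i j)) = M a b + M b a := by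
  have e : dp b (∑ i, ∑ j, p i * p j * M i j) = ∑ i, p i * M i b + ∑ j, p j * M b j := by
    simp only [map_sum, Derivation.leibniz, dp_p, h, smul_eq_mul, mul_zero, zero_add, add_mul,
      mul_ite, mul_one, ite_mul, zero_mul, Finset.sum_add_distrib, Finset.sum_ite_irrel,
      Finset.sum_const_zero,
      Finset.sum_ite_eq, Finset.mem_univ, if_true, mul_comm (M _ _)]
  rw [e]
  simp only [map_add, map_sum, Derivation.leibniz, dp_p, h, smul_eq_mul, mul_zero, zero_add,
    mul_ite, mul_one, Finset.sum_ite_eq, Finset.mem_univ, if_true]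

/-- Second derivatives of the curl of the divergence, arranged as a trace-free symmetric matrix. -/
noncomputable def vortHess (i j : Fin n) : PhasePoly n →ₗ[ℝ] PhasePoly n :=
  (dx j).toLinearMap ∘ₗ (dx j).toLinearMap ∘ₗ vort i j ∘ₗ cdiv +
    if i = j then ∑ k, (dx k).toLinearMap ∘ₗ (dx j).toLinearMap ∘ₗ vort k j ∘ₗ cdiv else 0

theorem vortHess_apply (i j : Fin n) (F : PhasePoly n) :
    vortHess i j F = dx j (dx j (vort i j (cdiv F))) +
      if i = j then ∑ k, dx k (dx j (vort k j (cdiv F))) else 0 := by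
  split_ifs with h <;> simp [vortHess, h, LinearMap.sum_apply]

theorem vortHess_mem {F : PhasePoly n} (hF : F ∈ bideg n 4 2) (i j : Fin n) :
    vortHess i j F ∈ bideg n 0 0 := by
  have hv (i j) : vort i j (cdiv F) ∈ bideg n 2 0 := vort_mem (cdiv_mem hF) i j
  rw [vortHess_apply]
  refine Submodule.add_mem _ (dx_mem (dx_mem (hv i j) j) j) ?_
  split_ifs
  · exact Submodule.sum_mem _ fun k _ => dx_mem (dx_mem (hv k j) j) k
  · exact Submodule.zero_mem _

/-- The quadratic form on momenta with matrix `vortHess`. -/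
noncomputable def toDegreeZero : PhasePoly n →ₗ[ℝ] PhasePoly n :=
  ∑ i, ∑ j, LinearMap.mulLeft ℝ (p i * p j) ∘ₗ vortHess i j

theorem toDegreeZero_apply (F : PhasePoly n) :
    toDegreeZero F = ∑ i, ∑ j, p i * p j * vortHess i j F := by
  simp only [toDegreeZero, LinearMap.sum_apply, LinearMap.comp_apply, LinearMap.mulLeft_apply]

theorem vort_swap (i j : Fin n) (G : PhasePoly n) : vort i j G = -vort j i G := by
  simp [vort_apply]

theorem vort_self (i : Fin n) (G : PhasePoly n) : vort i i G = 0 := by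
  simp [vort_apply]

theorem vortHess_symm {F : PhasePoly n} (hF : F ∈ ckt n 4) (i j : Fin n) :
    vortHess i j F = vortHess j i F := by
  rcases eq_or_ne i j with rfl | hij
  · rfl
  have := (confKillingEq_of_mem_ckt hF).sq_smul_curl_symm i j
  simp only [curl_dsym, pow_two, mul_smul, dsym_smul, Derivation.map_smul] at this
  simpa [vortHess_apply, hij, hij.symm] using smul_right_injective _ (two_ne_zero' ℝ) this

theorem dp_dp_toDegreeZero {F : PhasePoly n} (hF : F ∈ ckt n 4) (i j : Fin n) :
    dp i (dp j (toDegreeZero F)) = (2 : ℝ) • vortHess i j F := by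
  rw [toDegreeZero_apply, dp_dp_sum_mul fun a i j => dp_eq_zero (vortHess_mem hF.1 i j) a,
    ← vortHess_symm hF i j, two_smul]

theorem toDegreeZero_mem {F : PhasePoly n} (hF : F ∈ ckt n 4) : toDegreeZero F ∈ ckt n 0 := by
  have hm : toDegreeZero F ∈ bideg n 0 2 := by
    rw [toDegreeZero_apply]
    exact Submodule.sum_mem _ fun i _ => Submodule.sum_mem _ fun j _ =>
      mul_mem (mul_mem (p_mem i) (p_mem j)) (vortHess_mem hF.1 i j)
  refine ⟨hm, ?_, ?_⟩
  · have e : ∑ i, ∑ k, dx k (dx i (vort k i (cdiv F))) = 0 := by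
      have h : ∑ i, ∑ k, dx k (dx i (vort k i (cdiv F))) =
          -∑ i, ∑ k, dx k (dx i (vort k i (cdiv F))) := by
        conv_lhs => rw [Finset.sum_comm]
        simp only [← Finset.sum_neg_distrib]
        refine Finset.sum_congr rfl fun i _ => Finset.sum_congr rfl fun k _ => ?_
        rw [dx_comm, vort_swap, map_neg, map_neg]
      exact self_eq_neg.mp h
    simp [lapP_apply, dp_dp_toDegreeZero hF, vortHess_apply, vort_self, ← Finset.smul_sum, e]
  · rw [grad_eq_zero hm]
    simp [cdiv, divP_apply, dx_eq_zero (dp_mem hm _)]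

theorem eq_zero_of_toDegreeZero_eq_zero [NeZero n] {F : PhasePoly n} (hF : F ∈ ckt n 4)
    (h : toDegreeZero F = 0) : F = 0 := by
  have hM (i j) : vortHess i j F = 0 := by
    have := dp_dp_toDegreeZero hF i j
    rw [h, map_zero, map_zero] at this
    exact (smul_eq_zero.mp this.symm).resolve_left two_ne_zero
  have hE := confKillingEq_of_mem_ckt hF
  set W : Fin n → Fin n → PhasePoly n := fun i j => dx i (dx j (vort i j (cdiv F))) with hW
  have hWs (i j) : W i j = -W j i := by
    simp only [hW]
    rw [dx_comm, vort_swap, map_neg, map_neg]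
  have hWself (i) : W i i = 0 := self_eq_neg.mp (hWs i i)
  have hWc (i j k) : W i j + W k i = -W j k := by
    rcases eq_or_ne i j with rfl | hij
    · rw [hWs k i, hWself, zero_add]
    rcases eq_or_ne i k with rfl | hik
    · rw [hWs i j, hWself, add_zero]
    rcases eq_or_ne j k with rfl | hjk
    · rw [hWs i j, hWself, neg_add_cancel, neg_zero]
    have := hE.mul_smul_curl_cycle hij hik hjk
    simp only [curl_dsym, mul_smul, dsym_smul, Derivation.map_smul, ← smul_add] at this
    have := (smul_eq_zero.mp this).resolve_left two_ne_zero
    linear_combination this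
  have hWsum (j) : ∑ i, W i j = 0 := by
    have := hM j j
    rwa [vortHess_apply, if_pos rfl, vort_self, map_zero, map_zero, zero_add] at this
  have hW0 (j k) : W j k = 0 := by
    have e : ∑ i, (W i j + W k i) = 0 := by
      simp only [hWs k, Finset.sum_add_distrib, Finset.sum_neg_distrib, hWsum, neg_zero, add_zero]
    simp only [hWc, Finset.sum_const, Finset.card_univ, Fintype.card_fin, smul_neg] at e
    simpa [NeZero.ne n] using e
  refine eq_zero_of_vort_eq_zero (k := 1) hF fun i j => ?_
  have hv : vort i j (cdiv F) ∈ bideg n 2 0 := vort_mem (cdiv_mem hF.1) i j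
  refine eq_zero_of_dx_eq_zero hv fun l => eq_zero_of_dx_eq_zero (dx_mem hv l) fun k => ?_
  have := hE.second_smul_curl_eq_zero ?_ ?_ k l i j
  · rw [curl_dsym, mul_smul] at this
    simp only [dsym_smul, Derivation.map_smul] at this
    exact (smul_eq_zero.mp this).resolve_left two_ne_zero
  · intro i j hij
    have := hM i j
    rw [vortHess_apply, if_neg hij, add_zero] at this
    simp only [curl_dsym, pow_two, mul_smul, dsym_smul, Derivation.map_smul, this, smul_zero]
  · intro i j hij
    have := hW0 i j
    simp only [hW] at this
    simp only [curl_dsym, mul_smul, dsym_smul, Derivation.map_smul, this, smul_zero]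

end PhasePoly
end DegreeFourAndFive

section Inversion

open MvPolynomial

namespace PhasePoly

variable {n : ℕ}

/-- The squared norm of the position. -/
noncomputable def xsq (n : ℕ) : PhasePoly n := ∑ i, x i ^ 2

/-- The pairing of position and momentum. -/
noncomputable def xp (n : ℕ) : PhasePoly n := ∑ i, x i * p i

/-- The momentum transformed by the inversion. -/
noncomputable def invP (i : Fin n) : PhasePoly n := xsq n * p i - (2 : ℝ) • (xp n * x i)

theorem xsq_mem : xsq n ∈ bideg n 2 0 := by
  refine Submodule.sum_mem _ fun i _ => ?_
  rw [pow_two]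
  exact mul_mem (x_mem i) (x_mem i)

theorem xp_mem : xp n ∈ bideg n 1 1 := Submodule.sum_mem _ fun i _ => mul_mem (x_mem i) (p_mem i)

theorem invP_mem (i : Fin n) : invP i ∈ bideg n 2 1 :=
  Submodule.sub_mem _ (mul_mem xsq_mem (p_mem i))
    (Submodule.smul_mem _ _ (mul_mem xp_mem (x_mem i)))

@[simp] theorem grad_x (i : Fin n) : grad (x i) = p i := by
  simp only [grad_apply, dx_x, mul_ite, mul_one, mul_zero, Finset.sum_ite_eq', Finset.mem_univ,
    if_true]

@[simp] theorem grad_p (i : Fin n) : grad (p i) = 0 := by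
  simp only [grad_apply, dx_p, mul_zero, Finset.sum_const_zero]

theorem grad_xsq : grad (xsq n) = (2 : ℝ) • xp n := by
  simp only [xsq, xp, map_sum, pow_two, Derivation.leibniz, grad_x, smul_eq_mul, ← two_smul ℝ,
    Finset.smul_sum]

theorem grad_xp : grad (xp n) = psq n := by
  simp only [xp, psq, map_sum, Derivation.leibniz, grad_x, grad_p, smul_eq_mul, mul_zero, zero_add,
    pow_two]

theorem grad_invP (i : Fin n) : grad (invP i) = (-2 : ℝ) • (psq n * x i) := by
  simp only [invP, map_sub, Derivation.map_smul, Derivation.leibniz, grad_x, grad_p, grad_xsq,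
    grad_xp, smul_eq_mul, mul_zero, zero_add, mul_smul_comm, smul_add]
  rw [mul_comm (p i), mul_comm (x i)]
  module

theorem dp_xsq (i : Fin n) : dp i (xsq n) = 0 := dp_eq_zero xsq_mem i

theorem dp_xp (i : Fin n) : dp i (xp n) = x i := by
  simp only [xp, map_sum, Derivation.leibniz, dp_x, dp_p, smul_eq_mul, mul_zero, add_zero, mul_ite,
    mul_one, Finset.sum_ite_eq, Finset.mem_univ, if_true]

theorem dp_invP (a i : Fin n) :
    dp a (invP i) = (if a = i then xsq n else 0) - (2 : ℝ) • (x a * x i) := by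
  simp only [invP, map_sub, Derivation.map_smul, Derivation.leibniz, dp_x, dp_p, dp_xsq, dp_xp,
    smul_eq_mul, mul_zero, zero_add, add_zero, mul_ite, mul_one, mul_comm (x i)]

theorem dp_dp_invP (a b i : Fin n) : dp a (dp b (invP i)) = 0 :=
  dp_eq_zero (dp_mem (invP_mem i) b) a

theorem lapP_invP_mul (b c : Fin n) :
    lapP (invP b * invP c) = if b = c then (2 : ℝ) • xsq n ^ 2 else 0 := by
  have e (i : Fin n) : dp i (dp i (invP b * invP c)) =
      (2 : ℝ) • (dp i (invP b) * dp i (invP c)) := by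
    simp only [Derivation.leibniz, map_add, smul_eq_mul, dp_dp_invP, mul_zero, zero_add]
    rw [mul_comm (dp i (invP c)), two_smul]
  have e2 : ∑ i, x i * x i = xsq n := by simp only [xsq, pow_two]
  simp only [lapP_apply, e, ← Finset.smul_sum, dp_invP, sub_mul, mul_sub, ite_mul, zero_mul, 
    mul_ite, mul_zero, Finset.sum_sub_distrib, Finset.sum_ite_eq', Finset.mem_univ, if_true]
  have e3 : ∑ i, (2 : ℝ) • (x i * x b) * (2 : ℝ) • (x i * x c) =
      (4 : ℝ) • (xsq n * (x b * x c)) := by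
    rw [← e2, Finset.sum_mul, Finset.smul_sum]
    refine Finset.sum_congr rfl fun i _ => ?_
    rw [smul_mul_smul_comm]
    congr 1
    · norm_num
    · ring
  rw [e3]
  simp only [eq_comm (a := c), pow_two, mul_smul_comm, mul_comm _ (xsq n),
    mul_comm (x c)]
  split_ifs <;> module

/-- The substitution `p ↦ invP`, induced by the inversion. -/
noncomputable def inv : PhasePoly n →ₐ[ℝ] PhasePoly n := aeval (Sum.elim x invP)

@[simp] theorem inv_x (i : Fin n) : inv (x i) = x i := by simp [inv]

@[simp] theorem inv_p (i : Fin n) : inv (p i) = invP i := by simp [inv]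

theorem inv_xsq : inv (xsq n) = xsq n := by
  simp only [xsq, map_sum, map_pow, inv_x]

theorem inv_xp : inv (xp n) = -(xsq n * xp n) := by
  have : ∑ i : Fin n, x i * x i = xsq n := by simp only [xsq, pow_two]
  have e : ∑ i, x i * invP i = xsq n * ∑ i, x i * p i - (2 : ℝ) • (xp n * ∑ i, x i * x i) := by
    simp only [invP, mul_sub, Finset.sum_sub_distrib, Finset.mul_sum, mul_smul_comm,
      Finset.smul_sum,
      mul_left_comm (x _)]
  simp only [xp, map_sum, map_mul, inv_x, inv_p]
  rw [e, this, ← xp]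
  rw [mul_comm (xp n)]
  module

theorem inv_invP (i : Fin n) : inv (invP i) = xsq n ^ 2 * p i := by
  simp only [invP, map_sub, map_smul, map_mul, inv_xsq, inv_p, inv_x, inv_xp, mul_sub, neg_mul,
    mul_smul_comm, mul_assoc, pow_two]
  module

theorem two_smul_eq_sum {u : PhasePoly n} (h : u ∈ bideg n 0 2) :
    ∃ r : Fin n → Fin n → ℝ, (∀ b c, dp b (dp c u) = C (r b c)) ∧
      (2 : ℝ) • u = ∑ b, ∑ c, r b c • (p b * p c) := by
  choose r hr using fun b c => eq_C_of_mem_bideg (dp_mem (dp_mem h c) b)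
  refine ⟨r, hr, ?_⟩
  simp only [← sum_mul_dp_dp h, hr, C_mul']

theorem inv_mem_ckt {u : PhasePoly n} (hu : u ∈ ckt n 0) : inv u ∈ ckt n 4 := by
  obtain ⟨h1, h2, -⟩ := hu
  obtain ⟨r, hr, hs⟩ := two_smul_eq_sum h1
  have hi := congr_arg inv hs
  simp only [map_smul, map_sum, map_mul, inv_p] at hi
  suffices (2 : ℝ) • inv u ∈ ckt n 4 by
    simpa using Submodule.smul_mem _ (2⁻¹ : ℝ) this
  rw [hi]
  refine mem_ckt_of_grad_eq (k := 3)
    (G := ∑ b, ∑ c, r b c • (-2 : ℝ) • (x b * invP c + invP b * x c)) ?_ ?_ ?_ ?_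
  · exact Submodule.sum_mem _ fun b _ => Submodule.sum_mem _ fun c _ => Submodule.smul_mem _ _
      (mul_mem (invP_mem b) (invP_mem c))
  · exact Submodule.sum_mem _ fun b _ => Submodule.sum_mem _ fun c _ => Submodule.smul_mem _ _
      (Submodule.smul_mem _ _ (Submodule.add_mem _ (mul_mem (x_mem b) (invP_mem c))
        (mul_mem (invP_mem b) (x_mem c))))
  · have h3 : ∑ b, r b b = 0 := by
      apply C_injective (Fin n ⊕ Fin n) ℝ
      simpa only [lapP_apply, hr, ← map_sum, map_zero] using h2
    simp only [map_sum, map_smul, lapP_invP_mul, smul_ite, smul_zero, Finset.sum_ite_eq,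
      Finset.mem_univ, if_true, ← Finset.sum_smul, h3, zero_smul]
  · simp only [map_sum, Derivation.map_smul, Derivation.leibniz, grad_invP, smul_eq_mul,
      Finset.mul_sum, mul_smul_comm, mul_add, smul_add]
    refine Finset.sum_congr rfl fun b _ => Finset.sum_congr rfl fun c _ => ?_
    rw [mul_left_comm, mul_left_comm (invP c), mul_comm (invP c), add_comm]

theorem eq_zero_of_inv_eq_zero [NeZero n] {u : PhasePoly n} (hu : u ∈ bideg n 0 2)
    (h : inv u = 0) : u = 0 := by
  obtain ⟨r, -, hs⟩ := two_smul_eq_sum hu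
  have hx : xsq n ≠ 0 := fun h0 => by
    have := congr_arg (eval (fun _ => 1)) h0
    simp [xsq, NeZero.ne n] at this
  have e : inv (inv ((2 : ℝ) • u)) = xsq n ^ 4 * (2 : ℝ) • u := by
    have hp (b c : Fin n) : inv (inv (p b * p c)) = xsq n ^ 4 * (p b * p c) := by
      rw [map_mul, map_mul, inv_p, inv_p, inv_invP, inv_invP]
      ring
    simp only [hs, map_sum, map_smul, hp, Finset.mul_sum, mul_smul_comm]
  rw [map_smul, h, smul_zero, map_zero] at e
  simpa [hx] using e.symm

end PhasePoly
end Inversion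

section Dimensions

open MvPolynomial

namespace PhasePoly

variable {n : ℕ}

/-- Monomials of bidegree `(k, l)` are pairs of multisets of indices. -/
noncomputable def monomialEquiv (n k l : ℕ) :
    {d : Fin n ⊕ Fin n →₀ ℕ | Finsupp.weight wt d = (k, l)} ≃ Sym (Fin n) k × Sym (Fin n) l :=
  (Finsupp.sumFinsuppEquivProdFinsupp.subtypeEquiv (p := fun d => Finsupp.weight wt d = (k, l))
    (q := fun d => d.1.sum (fun _ => id) = k ∧ d.2.sum (fun _ => id) = l) fun d => by
      simp [Finsupp.weight_apply, Finsupp.sum_fintype, Prod.ext_iff, Prod.fst_sum, Prod.snd_sum,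
        wt]).trans <|
    (Equiv.subtypeProdEquivProd (p := fun d : Fin n →₀ ℕ => d.sum (fun _ => id) = k)
      (q := fun d : Fin n →₀ ℕ => d.sum (fun _ => id) = l)).trans <|
    (Equiv.prodCongr (Sym.equivNatSum (Fin n) k) (Sym.equivNatSum (Fin n) l)).symm

/-- The monomial basis of the space of bihomogeneous polynomials. -/
noncomputable def bidegBasis (n k l : ℕ) :
    Module.Basis (Sym (Fin n) k × Sym (Fin n) l) ℝ (bideg n k l) :=
  ((basisRestrictSupport ℝ {d : Fin n ⊕ Fin n →₀ ℕ | Finsupp.weight wt d = (k, l)}).map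
    (LinearEquiv.ofEq _ _ (weightedHomogeneousSubmodule_eq_finsupp_supported ℝ wt (k, l)).symm))
      |>.reindex (monomialEquiv n k l)

instance (k l : ℕ) : Module.Finite ℝ (bideg n k l) := Module.Finite.of_basis (bidegBasis n k l)

theorem finrank_bideg (n k l : ℕ) :
    Module.finrank ℝ (bideg n k l) = n.multichoose k * n.multichoose l := by
  rw [Module.finrank_eq_card_basis (bidegBasis n k l), Fintype.card_prod,
    Sym.card_sym_eq_multichoose, Sym.card_sym_eq_multichoose, Fintype.card_fin]

theorem ckt_le_bideg (n k : ℕ) : ckt n k ≤ bideg n k 2 := fun _ h => h.1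

instance (k : ℕ) : Module.Finite ℝ (ckt n k) :=
  Submodule.finiteDimensional_of_le (ckt_le_bideg n k)

theorem finrank_ckt_four [NeZero n] :
    Module.finrank ℝ (ckt n 4) = Module.finrank ℝ (ckt n 0) := by
  refine le_antisymm ?_ ?_
  · refine LinearMap.finrank_le_finrank_of_injective
      (f := toDegreeZero.restrict fun F (hF : F ∈ ckt n 4) => toDegreeZero_mem hF) ?_
    rw [injective_iff_map_eq_zero]
    exact fun F h => Subtype.ext (eq_zero_of_toDegreeZero_eq_zero F.2 (congr_arg Subtype.val h))
  · refine LinearMap.finrank_le_finrank_of_injective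
      (f := inv.toLinearMap.restrict fun F (hF : F ∈ ckt n 0) => inv_mem_ckt hF) ?_
    rw [injective_iff_map_eq_zero]
    exact fun F h => Subtype.ext (eq_zero_of_inv_eq_zero F.2.1 (congr_arg Subtype.val h))

theorem mem_ckt_zero {F : PhasePoly n} (hF : F ∈ bideg n 0 2) (h : lapP F = 0) : F ∈ ckt n 0 :=
  ⟨hF, h, by simp [grad_eq_zero hF, cdiv, divP_apply, dx_eq_zero (dp_mem hF _)]⟩

theorem finrank_ckt_zero [NeZero n] :
    Module.finrank ℝ (ckt n 0) + 1 = n.multichoose 2 := by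
  set T : bideg n 0 2 →ₗ[ℝ] bideg n 0 0 := lapP.restrict fun F hF => lapP_mem hF with hT
  have hs : Function.Surjective T := fun f => by
    refine ⟨(1 / (2 * n : ℝ)) • ⟨psq n * f, by simpa using psq_mul_mem f.2⟩, Subtype.ext ?_⟩
    have hn : (n : ℝ) ≠ 0 := NeZero.ne _
    rw [map_smul]
    change (1 / (2 * n : ℝ)) • lapP (psq n * f.1) = f.1
    rw [lapP_psq_mul f.2, smul_smul]
    field_simp
    simp
  have hk : (ckt n 0) = (LinearMap.ker T).map (bideg n 0 2).subtype := by
    ext F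
    constructor
    · exact fun h => ⟨⟨F, h.1⟩, Subtype.ext h.2.1, rfl⟩
    · rintro ⟨F, h, rfl⟩
      exact mem_ckt_zero F.2 (congr_arg Subtype.val h)
  have := LinearMap.finrank_range_add_finrank_ker T
  rw [LinearMap.range_eq_top.mpr hs, finrank_top, finrank_bideg, finrank_bideg] at this
  rw [hk, Submodule.finrank_map_subtype_eq]
  simp only [Nat.multichoose_zero_right, one_mul] at this
  omega

theorem exists_grad_eq {k : ℕ} (hk : k ≤ 2) {G : PhasePoly n} (hG : G ∈ bideg n k 3) :
    ∃ F ∈ bideg n (k + 1) 2, grad F = G := by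
  have h1 := cograd_mem hG
  have e1 := grad_cograd hG
  match k, hk with
  | 0, _ =>
    refine ⟨(1 / 3 : ℝ) • cograd G, Submodule.smul_mem _ _ h1, ?_⟩
    simp only [grad_eq_zero hG, map_zero, zero_add] at e1
    rw [Derivation.map_smul, e1]
    push_cast
    module
  | 1, _ =>
    have d1 := grad_mem hG
    have h2 := cograd_mem d1
    have e2 := grad_cograd d1
    have e3 := grad_cograd h2
    rw [grad_eq_zero d1, map_zero, zero_add] at e2
    rw [e2, Derivation.map_smul] at e3
    refine ⟨(1 / 2 : ℝ) • cograd G - (1 / 12 : ℝ) • cograd (cograd (grad G)),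
      Submodule.sub_mem _ (Submodule.smul_mem _ _ h1) (Submodule.smul_mem _ _ (cograd_mem h2)), ?_⟩
    rw [map_sub, Derivation.map_smul, Derivation.map_smul, e1, e3]
    push_cast
    module
  | 2, _ =>
    have d1 := grad_mem hG
    have d2 := grad_mem d1
    have h2 := cograd_mem d1
    have h3 := cograd_mem d2
    have h4 := cograd_mem h3
    have e2 := grad_cograd d1
    have e3 := grad_cograd h2
    have e4 := grad_cograd d2
    have e5 := grad_cograd h3
    have e6 := grad_cograd h4
    rw [grad_eq_zero d2, map_zero, zero_add] at e4
    rw [e4, Derivation.map_smul] at e5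
    rw [e5, map_add, Derivation.map_smul, Derivation.map_smul] at e6
    rw [e2, map_add, Derivation.map_smul] at e3
    refine ⟨cograd G - (1 / 4 : ℝ) • cograd (cograd (grad G)) +
        (1 / 36 : ℝ) • cograd (cograd (cograd (grad (grad G)))),
      Submodule.add_mem _ (Submodule.sub_mem _ h1 (Submodule.smul_mem _ _ (cograd_mem h2)))
        (Submodule.smul_mem _ _ (cograd_mem h4)), ?_⟩
    rw [map_add, map_sub, Derivation.map_smul, Derivation.map_smul, e1, e3, e6]
    push_cast
    module

/-- The conformal Killing equation for a field and its right-hand side. -/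
noncomputable def cktMap (n k : ℕ) :
    bideg n (k + 1) 2 × bideg n k 1 →ₗ[ℝ] bideg n k 3 × bideg n (k + 1) 0 :=
  LinearMap.prod
    (LinearMap.coprod (grad.toLinearMap.restrict fun _ hF => grad_mem hF)
      (-(LinearMap.mulLeft ℝ (psq n)).restrict fun _ hG => psq_mul_mem hG))
    ((lapP.restrict fun _ hF => lapP_mem hF) ∘ₗ LinearMap.fst ℝ _ _)

theorem cktMap_fst {k : ℕ} (y : bideg n (k + 1) 2 × bideg n k 1) :
    ((cktMap n k y).1 : PhasePoly n) = grad y.1.1 - psq n * y.2.1 := by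
  rw [sub_eq_add_neg]
  rfl

theorem cktMap_snd {k : ℕ} (y : bideg n (k + 1) 2 × bideg n k 1) :
    ((cktMap n k y).2 : PhasePoly n) = lapP y.1.1 := rfl

theorem mem_ker_cktMap {k : ℕ} {y : bideg n (k + 1) 2 × bideg n k 1} :
    y ∈ LinearMap.ker (cktMap n k) ↔ grad y.1.1 = psq n * y.2.1 ∧ lapP y.1.1 = 0 := by
  rw [LinearMap.mem_ker, Prod.ext_iff, Subtype.ext_iff, Subtype.ext_iff, cktMap_fst, cktMap_snd]
  simp [sub_eq_zero]

theorem cktMap_surjective [NeZero n] {k : ℕ} (hk : k ≤ 2) :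
    Function.Surjective (cktMap n k) := by
  rintro ⟨G, h⟩
  obtain ⟨F, hF, hFG⟩ := exists_grad_eq hk G.2
  have hf : (1 / (2 * n : ℝ)) • (h.1 - lapP F) ∈ bideg n (k + 1) 0 :=
    Submodule.smul_mem _ _ (Submodule.sub_mem _ h.2 (lapP_mem hF))
  refine ⟨⟨⟨F + psq n * _, Submodule.add_mem _ hF (psq_mul_mem hf)⟩, ⟨grad _, grad_mem hf⟩⟩,
    Prod.ext (Subtype.ext ?_) (Subtype.ext ?_)⟩
  · rw [cktMap_fst]
    change grad (F + psq n * _) - psq n * grad _ = G.1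
    rw [map_add, grad_psq_mul, hFG, add_sub_cancel_right]
  · have hn : (n : ℝ) ≠ 0 := NeZero.ne _
    rw [cktMap_snd]
    change lapP (F + psq n * _) = h.1
    rw [map_add, lapP_psq_mul hf, smul_smul, mul_one_div_cancel (by positivity), one_smul,
      add_sub_cancel]

/-- Solutions of the conformal Killing equation, with or without the right-hand side. -/
noncomputable def cktEquiv (n k : ℕ) : ckt n (k + 1) ≃ₗ[ℝ] LinearMap.ker (cktMap n k) where
  toFun F := ⟨⟨⟨F.1, F.2.1⟩, ⟨cdiv F.1, cdiv_mem F.2.1⟩⟩, mem_ker_cktMap.mpr ⟨F.2.2.2, F.2.2.1⟩⟩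
  invFun y := ⟨y.1.1.1, mem_ckt_of_grad_eq y.1.1.2 y.1.2.2 (mem_ker_cktMap.mp y.2).2
    (mem_ker_cktMap.mp y.2).1⟩
  map_add' F G := by ext <;> simp
  map_smul' r F := by ext <;> simp
  left_inv _ := rfl
  right_inv y := Subtype.ext <| Prod.ext rfl <| Subtype.ext <|
    (eq_cdiv y.1.1.2 y.1.2.2 (mem_ker_cktMap.mp y.2).2 (mem_ker_cktMap.mp y.2).1).symm

theorem finrank_ckt_succ [NeZero n] {k : ℕ} (hk : k ≤ 2) :
    Module.finrank ℝ (ckt n (k + 1)) + (n.multichoose k * n.multichoose 3 + n.multichoose (k + 1)) =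
      n.multichoose (k + 1) * n.multichoose 2 + n.multichoose k * n := by
  have := LinearMap.finrank_range_add_finrank_ker (cktMap n k)
  rw [LinearMap.range_eq_top.mpr (cktMap_surjective hk), finrank_top, Module.finrank_prod,
    Module.finrank_prod, ← (cktEquiv n k).finrank_eq] at this
  simp only [finrank_bideg, Nat.multichoose_zero_right, Nat.multichoose_one_right, mul_one] at this
  rw [add_comm, this]

theorem sum_finrank_ckt [NeZero n] : ∑ k : Fin 5, Module.finrank ℝ (ckt n k) =
    (n - 1) * (n + 2) * (n + 3) * (n + 4) / 12 := by
  obtain ⟨m, rfl⟩ := Nat.exists_eq_succ_of_ne_zero (NeZero.ne n)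
  have h0 := finrank_ckt_zero (n := m + 1)
  have h1 := finrank_ckt_succ (n := m + 1) (k := 0) (by norm_num)
  have h2 := finrank_ckt_succ (n := m + 1) (k := 1) (by norm_num)
  have h3 := finrank_ckt_succ (n := m + 1) (k := 2) (by norm_num)
  have h4 := finrank_ckt_four (n := m + 1)
  have m2 (j : ℕ) : 2 * j.multichoose 2 = j * (j + 1) := by
    induction j with
    | zero => simp
    | succ j ih => rw [Nat.multichoose_succ_succ, Nat.multichoose_one_right, mul_add, ih]; ring
  have m3 (j : ℕ) : 6 * j.multichoose 3 = j * (j + 1) * (j + 2) := by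
    induction j with
    | zero => simp
    | succ j ih => rw [Nat.multichoose_succ_succ, mul_add, ih]; linarith [m2 (j + 1)]
  replace m2 := m2 (m + 1)
  replace m3 := m3 (m + 1)
  simp only [Nat.multichoose_zero_right, Nat.multichoose_one_right, zero_add, one_add_one_eq_two,
    Nat.reduceAdd] at h1 h2 h3
  symm
  apply Nat.div_eq_of_eq_mul_right (by norm_num)
  simp only [Fin.sum_univ_five, Nat.succ_eq_add_one, Nat.add_sub_cancel, Fin.isValue,
    Fin.coe_ofNat_eq_mod, Nat.reduceMod, h4]
  generalize (m + 1).multichoose 2 = a at *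
  generalize (m + 1).multichoose 3 = b at *
  qify at *
  have ea : (a : ℚ) = (m + 1) * (m + 2) / 2 := by linarith
  have eb : (b : ℚ) = (m + 1) * (m + 2) * (m + 3) / 6 := by linarith
  rw [ea, eb] at h1 h2 h3
  rw [ea] at h0
  linear_combination -24 * h0 - 12 * h1 - 12 * h2 - 12 * h3

end PhasePoly
end Dimensions

section TaylorPolynomials

open MvPolynomial PhasePoly

/-- Smooth functions on `ℝⁿ`. -/
def smoothFun (n : ℕ) : Submodule ℝ ((Fin n → ℝ) → ℝ) where
  carrier := {f | ContDiff ℝ (⊤ : ℕ∞) f}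
  zero_mem' := (contDiff_const : ContDiff ℝ (⊤ : ℕ∞) fun _ : Fin n → ℝ => (0 : ℝ))
  add_mem' {f g} (hf : ContDiff ℝ (⊤ : ℕ∞) f) (hg : ContDiff ℝ (⊤ : ℕ∞) g) := hf.add hg
  smul_mem' r f (hf : ContDiff ℝ (⊤ : ℕ∞) f) := hf.const_smul r

namespace smoothFun

variable {n : ℕ}

theorem contDiff (f : smoothFun n) : ContDiff ℝ (⊤ : ℕ∞) f.1 := f.2

theorem differentiable (f : smoothFun n) : Differentiable ℝ f.1 :=
  (contDiff f).differentiable (by simp)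

theorem contDiff_pd {f : (Fin n → ℝ) → ℝ} (hf : ContDiff ℝ (⊤ : ℕ∞) f) (a : Fin n) :
    ContDiff ℝ (⊤ : ℕ∞) (pd a f) :=
  (hf.fderiv_right (m := (⊤ : ℕ∞)) le_rfl).clm_apply contDiff_const

/-- Partial derivatives as linear maps. -/
noncomputable def partialDeriv (a : Fin n) : smoothFun n →ₗ[ℝ] smoothFun n where
  toFun f := ⟨pd a f.1, contDiff_pd f.2 a⟩
  map_add' f g := Subtype.ext <| funext fun x => by
    simp [pd, fderiv_add (differentiable f x) (differentiable g x)]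
  map_smul' r f := Subtype.ext <| funext fun x => by
    simp [pd, fderiv_const_smul (differentiable f x)]

theorem partialDeriv_apply (a : Fin n) (f : smoothFun n) (x : Fin n → ℝ) :
    (partialDeriv a f).1 x = pd a f.1 x := rfl

theorem partialDeriv_comm (a b : Fin n) (f : smoothFun n) :
    partialDeriv a (partialDeriv b f) = partialDeriv b (partialDeriv a f) := by
  have key (a b : Fin n) (x : Fin n → ℝ) : (partialDeriv a (partialDeriv b f)).1 x =
      fderiv ℝ (fderiv ℝ f.1) x (Pi.single a 1) (Pi.single b 1) := by
    have h : DifferentiableAt ℝ (fderiv ℝ f.1) x :=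
      ((contDiff f).fderiv_right (m := (⊤ : ℕ∞)) le_rfl).differentiable (by simp) x
    change fderiv ℝ (fun y => fderiv ℝ f.1 y (Pi.single b 1)) x (Pi.single a 1) = _
    rw [fderiv_clm_apply h (differentiableAt_const _)]
    simp
  refine Subtype.ext <| funext fun x => ?_
  rw [key, key]
  have h2 : ((2 : ℕ∞) : WithTop ℕ∞) ≤ (⊤ : ℕ∞) := WithTop.coe_le_coe.mpr le_top
  exact (contDiff f).contDiffAt.isSymmSndFDerivAt (by simpa using! h2) _ _

theorem eq_of_partialDeriv_eq {f g : smoothFun n} (h : ∀ a, partialDeriv a f = partialDeriv a g)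
    (h0 : f.1 0 = g.1 0) : f = g := by
  rw [← sub_eq_zero]
  refine Subtype.ext <| funext fun x => ?_
  have hd : ∀ y, fderiv ℝ (f - g).1 y = 0 := fun y => by
    refine ContinuousLinearMap.coe_injective <| LinearMap.pi_ext' fun a => LinearMap.ext_ring ?_
    have := congr_fun (congr_arg Subtype.val (sub_eq_zero.mpr (h a))) y
    rwa [← map_sub] at this
  rw [is_const_of_fderiv_eq_zero (differentiable (f - g)) hd x 0]
  exact sub_eq_zero.mpr h0

/-- The Taylor polynomial at `x₀`, homogeneous of degree `k`, as a polynomial in the positions. -/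
noncomputable def taylor (x₀ : Fin n → ℝ) : ℕ → smoothFun n →ₗ[ℝ] PhasePoly n
  | 0 => Algebra.linearMap ℝ (PhasePoly n) ∘ₗ LinearMap.proj x₀ ∘ₗ (smoothFun n).subtype
  | k + 1 => (1 / ((k : ℝ) + 1)) •
      ∑ i, LinearMap.mulLeft ℝ (x i) ∘ₗ taylor x₀ k ∘ₗ partialDeriv i

theorem taylor_zero (x₀ : Fin n → ℝ) (f : smoothFun n) : taylor x₀ 0 f = C (f.1 x₀) := rfl

theorem taylor_succ (x₀ : Fin n → ℝ) (k : ℕ) (f : smoothFun n) :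
    taylor x₀ (k + 1) f = (1 / ((k : ℝ) + 1)) • ∑ i, x i * taylor x₀ k (partialDeriv i f) := by
  simp [taylor]

theorem taylor_mem (x₀ : Fin n → ℝ) (k : ℕ) (f : smoothFun n) : taylor x₀ k f ∈ bideg n k 0 := by
  induction k generalizing f with
  | zero => exact isWeightedHomogeneous_C wt _
  | succ k ih =>
    rw [taylor_succ, add_comm k]
    exact Submodule.smul_mem _ _ (Submodule.sum_mem _ fun i _ => mul_mem (x_mem i) (ih _))

theorem dx_taylor_succ (x₀ : Fin n → ℝ) (k : ℕ) (f : smoothFun n) (a : Fin n) :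
    dx a (taylor x₀ (k + 1) f) = taylor x₀ k (partialDeriv a f) := by
  induction k generalizing f with
  | zero => simp [taylor_succ, taylor_zero, pderiv_X, Pi.single_apply]
  | succ k ih =>
    have e : ∑ i, x i * dx a (taylor x₀ (k + 1) (partialDeriv i f)) =
        ((k : ℝ) + 1) • taylor x₀ (k + 1) (partialDeriv a f) := by
      simp only [ih, partialDeriv_comm a]
      rw [taylor_succ, smul_smul, mul_one_div_cancel (by positivity), one_smul]
    rw [taylor_succ, Derivation.map_smul, map_sum]
    simp only [Derivation.leibniz, dx_x, smul_eq_mul, mul_ite, mul_one, mul_zero,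
      Finset.sum_add_distrib, e, Finset.sum_ite_eq, Finset.mem_univ, if_true]
    push_cast
    match_scalars
    field_simp

theorem contDiff_eval (P : PhasePoly n) :
    ContDiff ℝ (⊤ : ℕ∞) fun y : Fin n → ℝ => eval (Sum.elim y 0) P := by
  induction P using MvPolynomial.induction_on with
  | C r => simpa using contDiff_const
  | add P Q hP hQ => simpa using! hP.add hQ
  | mul_X P i hP =>
    simp only [map_mul, eval_X]
    refine hP.mul ?_
    cases i with
    | inl i => exact contDiff_apply ℝ ℝ i
    | inr i => exact contDiff_const

/-- The function on position space obtained by setting the momenta to zero. -/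
noncomputable def ofPhasePoly : PhasePoly n →ₗ[ℝ] smoothFun n where
  toFun P := ⟨fun y => eval (Sum.elim y 0) P, contDiff_eval P⟩
  map_add' P Q := Subtype.ext <| funext fun y => by simp
  map_smul' r P := Subtype.ext <| funext fun y => by simp

theorem ofPhasePoly_apply (P : PhasePoly n) (y : Fin n → ℝ) :
    (ofPhasePoly P).1 y = eval (Sum.elim y 0) P := rfl

theorem partialDeriv_ofPhasePoly (a : Fin n) (P : PhasePoly n) :
    partialDeriv a (ofPhasePoly P) = ofPhasePoly (dx a P) := by
  refine Subtype.ext <| funext fun y => ?_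
  induction P using MvPolynomial.induction_on with
  | C r =>
    rw [pderiv_C, map_zero]
    change fderiv ℝ (fun y => eval (Sum.elim y 0) (C r)) y _ = 0
    simp
  | add P Q hP hQ =>
    rw [map_add, map_add, map_add, map_add]
    exact congr_arg₂ (· + ·) hP hQ
  | mul_X P i hP =>
    have hX : ∃ L : (Fin n → ℝ) →L[ℝ] ℝ, ∀ y : Fin n → ℝ, L y = (Sum.elim y 0 : _ → ℝ) i := by
      cases i with
      | inl i => exact ⟨ContinuousLinearMap.proj i, fun _ => rfl⟩
      | inr i => exact ⟨0, fun _ => rfl⟩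
    obtain ⟨L, hL⟩ := hX
    have e : (ofPhasePoly (P * X i)).1 = fun y => (ofPhasePoly P).1 y * L y :=
      funext fun y => by simp [ofPhasePoly_apply, hL]
    have hL1 : L (Pi.single a 1) = eval (Sum.elim y 0) (dx a (X i : PhasePoly n)) := by
      rw [hL]
      cases i with
      | inl i => simp [pderiv_X, Pi.single_apply, apply_ite, eq_comm]
      | inr i => simp [pderiv_X]
    rw [partialDeriv_apply, ofPhasePoly_apply] at hP ⊢
    rw [pd, e, fderiv_fun_mul (differentiable (ofPhasePoly P) y) L.differentiableAt,
      L.fderiv, Derivation.leibniz, smul_eq_mul, smul_eq_mul, map_add, map_mul, map_mul, ← hP,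
      ← hL1,
      eval_X, ← hL]
    simp [pd, ofPhasePoly_apply]

theorem taylor_ofPhasePoly {j k : ℕ} {P : PhasePoly n} (hP : P ∈ bideg n k 0) :
    taylor 0 j (ofPhasePoly P) = if j = k then P else 0 := by
  induction j generalizing k P with
  | zero =>
    rw [taylor_zero, ofPhasePoly_apply]
    cases k with
    | zero =>
      obtain ⟨r, rfl⟩ := eq_C_of_mem_bideg hP
      simp
    | succ k =>
      have := congr_arg (eval (Sum.elim 0 0)) (euler_x hP)
      have hk : (k : ℝ) + 1 ≠ 0 := by positivity
      simp [hk] at this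
      simp [← this]
  | succ j ih =>
    simp only [taylor_succ, partialDeriv_ofPhasePoly]
    cases k with
    | zero => simp [dx_eq_zero hP]
    | succ k =>
      simp only [ih (dx_mem hP _), add_left_inj]
      split_ifs with h
      · subst h
        rw [euler_x hP, smul_smul]
        push_cast
        rw [one_div_mul_cancel (by positivity), one_smul]
      · simp

theorem eq_sum_taylor {k : ℕ} {f : smoothFun n} (h : ∀ x₀, taylor x₀ k f = 0) :
    f = ∑ j ∈ Finset.range k, ofPhasePoly (taylor 0 j f) := by
  induction k generalizing f with
  | zero => exact Subtype.ext <| funext fun y => by simpa [taylor_zero] using h y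
  | succ k ih =>
    refine eq_of_partialDeriv_eq (fun a => ?_) ?_
    · rw [ih (f := partialDeriv a f) fun x₀ => by rw [← dx_taylor_succ, h, map_zero],
        Finset.sum_range_succ', map_add,
        map_sum, partialDeriv_ofPhasePoly a (taylor 0 0 f), dx_eq_zero (taylor_mem _ _ _), map_zero,
        add_zero]
      exact Finset.sum_congr rfl fun j _ => by rw [partialDeriv_ofPhasePoly, dx_taylor_succ]
    · have h0 : ∀ j, (ofPhasePoly (taylor 0 (j + 1) f)).1 0 = 0 := fun j => by
        simp [ofPhasePoly_apply, taylor_succ]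
      simp [Finset.sum_range_succ', h0, ofPhasePoly_apply, taylor_zero]

end smoothFun
end TaylorPolynomials

section Main

open MvPolynomial PhasePoly smoothFun

variable {n : ℕ}

namespace smoothFun

/-- The conformal Killing equation for the components of a smooth trace-free symmetric tensor. -/
structure IsConfKilling (v : Fin n → Fin n → smoothFun n) : Prop where
  symm : ∀ b c, v b c = v c b
  trace : ∑ b, v b b = 0
  eqn : ∀ a b c, partialDeriv a (v b c) + partialDeriv b (v c a) + partialDeriv c (v a b) =
      (2 / ((n : ℝ) + 2)) • ((if a = b then ∑ e, partialDeriv e (v c e) else 0) +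
        (if b = c then ∑ e, partialDeriv e (v a e) else 0) +
        (if c = a then ∑ e, partialDeriv e (v b e) else 0))

theorem sum_coe (y : Fin n → ℝ) (g : Fin n → smoothFun n) : (∑ e, g e).1 y = ∑ e, (g e).1 y := by
  simp

theorem ite_coe (P : Prop) [Decidable P] (y : Fin n → ℝ) (f : smoothFun n) :
    (if P then f else 0).1 y = (if P then 1 else 0) * f.1 y := by
  split_ifs <;> simp

theorem isCKT2_iff_isConfKilling (v : Fin n → Fin n → smoothFun n) :
    IsCKT2 n (fun y b c => (v b c).1 y) ↔ IsConfKilling v := by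
  have symm : (∀ y b c, (v b c).1 y = (v c b).1 y) ↔ ∀ b c, v b c = v c b :=
    ⟨fun h b c => Subtype.ext <| funext fun y => h y b c, fun h y b c => by rw [h]⟩
  have trace : (∀ y, ∑ b, (v b b).1 y = 0) ↔ ∑ b, v b b = 0 := by
    rw [Subtype.ext_iff, funext_iff]
    simp only [sum_coe]
    rfl
  have eqn (a b c : Fin n) : (∀ y, pd a (v b c).1 y + pd b (v c a).1 y + pd c (v a b).1 y =
      2 / ((n : ℝ) + 2) * ((if a = b then 1 else 0) * (∑ e, pd e (v c e).1 y) +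
        (if b = c then 1 else 0) * (∑ e, pd e (v a e).1 y) +
        (if c = a then 1 else 0) * (∑ e, pd e (v b e).1 y))) ↔
      partialDeriv a (v b c) + partialDeriv b (v c a) + partialDeriv c (v a b) =
        (2 / ((n : ℝ) + 2)) • ((if a = b then ∑ e, partialDeriv e (v c e) else 0) +
          (if b = c then ∑ e, partialDeriv e (v a e) else 0) +
          (if c = a then ∑ e, partialDeriv e (v b e) else 0)) := by
    rw [Subtype.ext_iff, funext_iff]
    refine forall_congr' fun y => ?_
    rw [Submodule.coe_smul, Pi.smul_apply, smul_eq_mul]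
    simp only [Submodule.coe_add, Pi.add_apply, ite_coe, sum_coe, partialDeriv_apply]
  constructor
  · rintro ⟨-, h2, h3, h4⟩
    exact ⟨symm.mp h2, trace.mp h3, fun a b c => (eqn a b c).mp (h4 a b c)⟩
  · rintro ⟨h2, h3, h4⟩
    exact ⟨fun a b => contDiff (v a b), symm.mpr h2, trace.mpr h3,
      fun a b c => (eqn a b c).mpr (h4 a b c)⟩

end smoothFun

namespace PhasePoly

/-- The symmetric tensor field with generating polynomial `F`. -/
noncomputable def tensor : PhasePoly n →ₗ[ℝ] (Fin n → ℝ) → Fin n → Fin n → ℝ where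
  toFun F y b c := (ofPhasePoly ((1 / 2 : ℝ) • dp b (dp c F))).1 y
  map_add' F G := by ext y b c; simp
  map_smul' r F := by ext y b c; simp; ring

theorem dx_dp_dp_add_of_mem_ckt {k : ℕ} {F : PhasePoly n} (hF : F ∈ ckt n k) (a b c : Fin n) :
    dx a (dp b (dp c F)) + dx b (dp c (dp a F)) + dx c (dp a (dp b F)) =
      (2 / ((n : ℝ) + 2)) • ((if a = b then ∑ e, dx e (dp c (dp e F)) else 0) +
        (if b = c then ∑ e, dx e (dp a (dp e F)) else 0) +
        (if c = a then ∑ e, dx e (dp b (dp e F)) else 0)) := by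
  have h (c : Fin n) : (2 : ℝ) • dp c (cdiv F) =
      (2 / ((n : ℝ) + 2)) • ∑ e, dx e (dp c (dp e F)) := by
    simp only [cdiv, LinearMap.smul_apply, Derivation.map_smul, divP_apply, map_sum, dp_dx,
      smul_smul, mul_one_div]
  have hl : ∃ l, cdiv F ∈ bideg n l 1 := by
    cases k with
    | zero =>
      refine ⟨0, ?_⟩
      simp [cdiv, divP_apply, dx_eq_zero (dp_mem hF.1 _)]
    | succ k => exact ⟨k, cdiv_mem hF.1⟩
  obtain ⟨l, hl⟩ := hl
  rw [dx_dp_dp_add hF.1 hl hF.2.2]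
  simp only [h, smul_add, smul_ite, smul_zero]

theorem isCKT2_tensor (F : ∀ k : Fin 5, ckt n k) : IsCKT2 n (tensor (∑ k, (F k).1)) := by
  have key : ∀ a b c : Fin n,
      dx a (dp b (dp c (∑ k, (F k).1))) + dx b (dp c (dp a (∑ k, (F k).1))) +
        dx c (dp a (dp b (∑ k, (F k).1))) =
      (2 / ((n : ℝ) + 2)) • ((if a = b then ∑ e, dx e (dp c (dp e (∑ k, (F k).1))) else 0) +
        (if b = c then ∑ e, dx e (dp a (dp e (∑ k, (F k).1))) else 0) +
        (if c = a then ∑ e, dx e (dp b (dp e (∑ k, (F k).1))) else 0)) := by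
    refine Finset.sum_induction _ (fun F : PhasePoly n => ∀ a b c : Fin n,
      dx a (dp b (dp c F)) + dx b (dp c (dp a F)) + dx c (dp a (dp b F)) =
        (2 / ((n : ℝ) + 2)) • ((if a = b then ∑ e, dx e (dp c (dp e F)) else 0) +
          (if b = c then ∑ e, dx e (dp a (dp e F)) else 0) +
          (if c = a then ∑ e, dx e (dp b (dp e F)) else 0))) (fun F G hF hG a b c => ?_)
      (by simp) fun k _ => dx_dp_dp_add_of_mem_ckt (F k).2
    simp only [map_add, Finset.sum_add_distrib, ite_add_zero]
    linear_combination (norm := module) hF a b c + hG a b c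
  refine (isCKT2_iff_isConfKilling fun b c =>
    ofPhasePoly ((1 / 2 : ℝ) • dp b (dp c (∑ k, (F k).1)))).mpr ⟨fun b c => ?_, ?_, fun a b c => ?_⟩
  · rw [dp_comm]
  · rw [← map_sum, ← Finset.smul_sum, ← lapP_apply, map_sum,
      Finset.sum_eq_zero fun k _ => (F k).2.2.1, smul_zero, map_zero]
  · have e := congr_arg (fun G => ofPhasePoly ((1 / 2 : ℝ) • G)) (key a b c)
    simp only [partialDeriv_ofPhasePoly, Derivation.map_smul, ← map_sum ofPhasePoly,
      ← Finset.smul_sum]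
    rw [← map_add, ← map_add, ← smul_add, ← smul_add, e, smul_comm, map_smul]
    simp only [smul_add, map_add, smul_ite, smul_zero, apply_ite ofPhasePoly, map_zero]

/-- The generating polynomial of the Taylor polynomial of a symmetric tensor field. -/
noncomputable def taylorTensor (x₀ : Fin n → ℝ) (k : ℕ) (v : Fin n → Fin n → smoothFun n) :
    PhasePoly n :=
  ∑ b, ∑ c, taylor x₀ k (v b c) * (p b * p c)

theorem dp_dp_taylorTensor (x₀ : Fin n → ℝ) (k : ℕ) {v : Fin n → Fin n → smoothFun n}
    (h : ∀ b c, v b c = v c b) (b c : Fin n) :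
    dp b (dp c (taylorTensor x₀ k v)) = (2 : ℝ) • taylor x₀ k (v b c) := by
  simp only [taylorTensor, map_sum, Derivation.leibniz, dp_eq_zero (taylor_mem _ _ _), dp_p,
    smul_eq_mul, mul_zero, add_zero, map_add, mul_ite, mul_one,
    apply_ite (dp b), map_zero, mul_add, Finset.sum_add_distrib, Finset.sum_ite_eq,
    Finset.mem_univ, if_true]
  rw [Finset.sum_comm]
  simp only [Finset.sum_ite_eq, Finset.mem_univ, if_true, h c b, two_smul]

theorem dx_taylorTensor_succ (x₀ : Fin n → ℝ) (k : ℕ) (v : Fin n → Fin n → smoothFun n)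
    (a : Fin n) :
    dx a (taylorTensor x₀ (k + 1) v) = taylorTensor x₀ k fun b c => partialDeriv a (v b c) := by
  simp only [taylorTensor, map_sum, Derivation.leibniz, dx_taylor_succ, dx_p, smul_eq_mul,
    mul_zero, add_zero, zero_add, mul_comm (p _ * p _)]

theorem taylorTensor_mem_bideg (x₀ : Fin n → ℝ) (k : ℕ) (v : Fin n → Fin n → smoothFun n) :
    taylorTensor x₀ k v ∈ bideg n k 2 :=
  Submodule.sum_mem _ fun b _ => Submodule.sum_mem _ fun c _ => by
    simpa using mul_mem (taylor_mem x₀ k (v b c)) (mul_mem (p_mem b) (p_mem c))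

theorem sum_rotate {ι M : Type*} [Fintype ι] [AddCommMonoid M] (g : ι → ι → ι → M) :
    ∑ a, ∑ b, ∑ c, g b c a = ∑ a, ∑ b, ∑ c, g a b c := by
  rw [Finset.sum_comm]
  exact Finset.sum_congr rfl fun b _ => Finset.sum_comm

theorem grad_taylorTensor_succ (x₀ : Fin n → ℝ) (k : ℕ) {v : Fin n → Fin n → smoothFun n}
    (hv : IsConfKilling v) :
    grad (taylorTensor x₀ (k + 1) v) =
      psq n * ((2 / ((n : ℝ) + 2)) • ∑ c, taylor x₀ k (∑ e, partialDeriv e (v c e)) * p c) := by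
  set w : Fin n → PhasePoly n := fun c => taylor x₀ k (∑ e, partialDeriv e (v c e))
  set g : Fin n → Fin n → Fin n → PhasePoly n := fun a b c =>
    taylor x₀ k (partialDeriv a (v b c)) * (p a * (p b * p c)) with hg
  have hgrad : grad (taylorTensor x₀ (k + 1) v) = ∑ a, ∑ b, ∑ c, g a b c := by
    simp only [grad_apply, dx_taylorTensor_succ]
    simp only [taylorTensor, Finset.mul_sum, hg]
    exact Finset.sum_congr rfl fun a _ => Finset.sum_congr rfl fun b _ =>
      Finset.sum_congr rfl fun c _ => mul_left_comm _ _ _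
  have hsum : ∑ a, ∑ b, ∑ c, (g a b c + g b c a + g c a b) =
      (2 / ((n : ℝ) + 2)) • ((3 : ℝ) • (psq n * ∑ c, w c * p c)) := by
    have hterm (a b c : Fin n) : g a b c + g b c a + g c a b = (2 / ((n : ℝ) + 2)) •
        ((if a = b then w c * (p a * (p b * p c)) else 0) +
        (if b = c then w a * (p a * (p b * p c)) else 0) +
        (if c = a then w b * (p a * (p b * p c)) else 0)) := by
      have e := congr_arg (fun f => taylor x₀ k f * (p a * (p b * p c))) (hv.eqn a b c)
      simp only [map_add, map_smul, apply_ite (taylor x₀ k), map_zero, smul_mul_assoc, add_mul,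
        ite_mul, zero_mul] at e
      rw [← e]
      simp only [hg]
      ring
    have e1 : ∑ a, ∑ b, ∑ c, (if a = b then w c * (p a * (p b * p c)) else 0) =
        psq n * ∑ c, w c * p c := by
      rw [psq, Finset.sum_mul_sum]
      refine Finset.sum_congr rfl fun a _ => ?_
      rw [Finset.sum_comm]
      simp only [Finset.sum_ite_eq, Finset.mem_univ, if_true]
      exact Finset.sum_congr rfl fun c _ => by ring
    have e2 : ∑ a, ∑ b, ∑ c, (if b = c then w a * (p a * (p b * p c)) else 0) =
        psq n * ∑ c, w c * p c := by
      rw [psq, Finset.sum_mul_sum, Finset.sum_comm]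
      simp only [Finset.sum_ite_eq, Finset.mem_univ, if_true]
      exact Finset.sum_congr rfl fun b _ => Finset.sum_congr rfl fun a _ => by ring
    have e3 : ∑ a, ∑ b, ∑ c, (if c = a then w b * (p a * (p b * p c)) else 0) =
        psq n * ∑ c, w c * p c := by
      rw [psq, Finset.sum_mul_sum]
      simp only [Finset.sum_ite_eq', Finset.mem_univ, if_true]
      exact Finset.sum_congr rfl fun a _ => Finset.sum_congr rfl fun b _ => by ring
    simp only [hterm, ← Finset.smul_sum, Finset.sum_add_distrib, e1, e2, e3]
    module
  simp only [Finset.sum_add_distrib] at hsum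
  rw [sum_rotate g, (sum_rotate fun a b c => g b c a).trans (sum_rotate g), ← hgrad] at hsum
  rw [mul_smul_comm]
  linear_combination (norm := module) (1 / 3 : ℝ) • hsum

theorem taylor_mul_p_mem (x₀ : Fin n → ℝ) (k : ℕ) (f : smoothFun n) (c : Fin n) :
    taylor x₀ k f * p c ∈ bideg n k 1 := by
  simpa using mul_mem (taylor_mem x₀ k f) (p_mem c)

theorem taylorTensor_mem_ckt (x₀ : Fin n → ℝ) (k : ℕ) {v : Fin n → Fin n → smoothFun n}
    (hv : IsConfKilling v) :
    taylorTensor x₀ k v ∈ ckt n k := by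
  have hF := taylorTensor_mem_bideg x₀ k v
  have hl : lapP (taylorTensor x₀ k v) = 0 := by
    simp only [lapP_apply, dp_dp_taylorTensor x₀ k hv.symm]
    rw [← Finset.smul_sum, ← map_sum, hv.trace, map_zero, smul_zero]
  cases k with
  | zero => exact mem_ckt_zero hF hl
  | succ k =>
    refine mem_ckt_of_grad_eq hF (Submodule.smul_mem _ _ (Submodule.sum_mem _ fun c _ => ?_)) hl
      (grad_taylorTensor_succ x₀ k hv)
    exact taylor_mul_p_mem x₀ k _ c

theorem tensor_injective {F : ∀ k : Fin 5, ckt n k} (h : tensor (∑ k, (F k).1) = 0) : F = 0 := by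
  funext k
  refine Subtype.ext ?_
  have hF := (F k).2.1
  refine eq_zero_of_dp_eq_zero hF fun c => eq_zero_of_dp_eq_zero (dp_mem hF c) fun b => ?_
  have h1 : ofPhasePoly (∑ j, (1 / 2 : ℝ) • dp b (dp c (F j).1)) = 0 := by
    refine Subtype.ext <| funext fun y => ?_
    rw [← Finset.smul_sum, ← map_sum, ← map_sum]
    exact congr_fun (congr_fun (congr_fun h y) b) c
  have h2 := congr_arg (taylor 0 k) h1
  rw [map_sum, map_sum, map_zero, Finset.sum_eq_single k] at h2
  · rw [taylor_ofPhasePoly (Submodule.smul_mem _ _ (dp_mem (dp_mem hF _) _)), if_pos rfl] at h2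
    exact (smul_eq_zero.mp h2).resolve_left (by norm_num)
  · intro j _ hj
    rw [taylor_ofPhasePoly (Submodule.smul_mem _ _ (dp_mem (dp_mem (F j).2.1 _) _)),
      if_neg fun h => hj (Fin.ext h.symm)]
  · simp

theorem exists_tensor_eq (hn : 3 ≤ n) {V : (Fin n → ℝ) → Fin n → Fin n → ℝ} (hV : IsCKT2 n V) :
    ∃ F : ∀ k : Fin 5, ckt n k, tensor (∑ k, (F k).1) = V := by
  obtain ⟨v, rfl⟩ : ∃ v : Fin n → Fin n → smoothFun n, (fun y b c => (v b c).1 y) = V :=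
    ⟨fun b c => ⟨fun y => V y b c, hV.1 b c⟩, rfl⟩
  have hv := (isCKT2_iff_isConfKilling v).mp hV
  have h5 (b c : Fin n) (x₀ : Fin n → ℝ) : taylor x₀ 5 (v b c) = 0 := by
    have := taylorTensor_mem_ckt x₀ 5 hv
    rw [ckt_five hn, Submodule.mem_bot] at this
    have e := dp_dp_taylorTensor x₀ 5 hv.symm b c
    rw [this, map_zero, map_zero] at e
    exact (smul_eq_zero.mp e.symm).resolve_left (by norm_num)
  refine ⟨fun k => ⟨taylorTensor 0 k v, taylorTensor_mem_ckt 0 k hv⟩, ?_⟩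
  funext y b c
  change (ofPhasePoly ((1 / 2 : ℝ) • dp b (dp c (∑ k : Fin 5, taylorTensor 0 k v)))).1 y = _
  rw [eq_sum_taylor (h5 b c), Finset.sum_range]
  simp only [map_sum, dp_dp_taylorTensor 0 _ hv.symm, Finset.smul_sum, smul_smul]
  norm_num

end PhasePoly

end Main

/-- For n ≥ 3, the conformal Killing 2-tensors on ℝⁿ form a real vector subspace of the
space of smooth symmetric trace-free 2-tensor fields, of dimension
`(n−1)(n+2)(n+3)(n+4)/12`. -/
theorem stmt_8 (n : ℕ) (hn : 3 ≤ n) :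
    ∃ W : Submodule ℝ ((Fin n → ℝ) → Fin n → Fin n → ℝ),
      (∀ V, V ∈ W ↔ IsCKT2 n V) ∧
      Module.finrank ℝ W = (n - 1) * (n + 2) * (n + 3) * (n + 4) / 12 := by
  have : NeZero n := ⟨by omega⟩
  let Φ : (∀ k : Fin 5, PhasePoly.ckt n k) →ₗ[ℝ] (Fin n → ℝ) → Fin n → Fin n → ℝ :=
    PhasePoly.tensor ∘ₗ ∑ k : Fin 5, (PhasePoly.ckt n k).subtype ∘ₗ LinearMap.proj k
  have hΦ (F : ∀ k : Fin 5, PhasePoly.ckt n k) : Φ F = PhasePoly.tensor (∑ k, (F k).1) := by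
    simp [Φ]
  refine ⟨LinearMap.range Φ, fun V => ⟨?_, fun hV => ?_⟩, ?_⟩
  · rintro ⟨F, rfl⟩
    rw [hΦ]
    exact PhasePoly.isCKT2_tensor F
  · obtain ⟨F, hF⟩ := PhasePoly.exists_tensor_eq hn hV
    exact ⟨F, (hΦ F).trans hF⟩
  · rw [LinearMap.finrank_range_of_inj, Module.finrank_pi_fintype, PhasePoly.sum_finrank_ckt]
    rw [injective_iff_map_eq_zero]
    exact fun F hF => PhasePoly.tensor_injective ((hΦ F).symm.trans hF)
end
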